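/- arXiv:2601.11470 — 2 statements merged into one kernel-verified Lean document; each statement's English description precedes it below -/
import Mathlib

section
/- Let μ be a Borel probability measure on ℝ, let r = (r_k)_{k≥1} be a non-increasing sequence of positive real numbers tending to zero with sup_{x∈X} μ(B(x,r_1)) < 1, and let A ⊆ ℝ be a non-empty analytic set. Then ℙ_μ({ω : A ⊆ E_r(ω)}) = 1 if and only if for every Borel probability measure ν whose support is a compact subset of A, the sequence of second moments (𝔼_{ℙ_μ}(M_{k,ν}²))_{k≥1} is unbounded. -/
open MeasureTheory Metric Filter Set
open scoped ENNReal Topology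

noncomputable section

/-- The random covering set `E_r(ω) = limsup_n B(ω_n, r_n)`. -/
def coverSet (r : ℕ → ℝ) (ω : ℕ → ℝ) : Set ℝ :=
  ⋂ k, ⋃ n, ⋃ (_ : k ≤ n), ball (ω n) (r n)

/-- The topological support of a measure. -/
def msupport (μ : Measure ℝ) : Set ℝ :=
  {x | ∀ U : Set ℝ, IsOpen U → x ∈ U → 0 < μ U}

/-- The martingale `M_{k,ν}(ω) = ∫ ∏_{n=1}^k (1 - 1_{B(ω_n,r_n)}(x))/(1 - μ(B(x,r_n))) dν(x)`. -/
def Mart (μ : Measure ℝ) (r : ℕ → ℝ) (ν : Measure ℝ) (k : ℕ) (ω : ℕ → ℝ) : ℝ :=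
  ∫ x, ∏ n ∈ Finset.range k,
    (1 - Set.indicator (ball (ω n) (r n)) (fun _ => (1 : ℝ)) x) /
      (1 - (μ (ball x (r n))).toReal) ∂ν

/-- The law of an i.i.d. sequence of random centres with common law `μ`. -/
abbrev iidLaw (μ : Measure ℝ) [IsProbabilityMeasure μ] : Measure (ℕ → ℝ) :=
  Measure.infinitePi fun _ => μ

/-- The points lying in none of the balls `B(ω_n, r_n)`, `n ≥ N`. -/
def freeSet (r : ℕ → ℝ) (N : ℕ) (ω : ℕ → ℝ) : Set ℝ :=
  {x | ∀ n, N ≤ n → x ∉ ball (ω n) (r n)}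

/-- The event that the balls `B(ω_n, r_n)`, `n ≥ N`, fail to cover `S`. -/
def missEvent (r : ℕ → ℝ) (N : ℕ) (S : Set ℝ) : Set (ℕ → ℝ) :=
  {ω | (S ∩ freeSet r N ω).Nonempty}

/-- The leftmost point of `K` lying in none of the balls `B(ω_n, r_n)`, `n ≥ N`. -/
def leftmostFree (r : ℕ → ℝ) (N : ℕ) (K : Set ℝ) (ω : ℕ → ℝ) : ℝ :=
  sInf (K ∩ freeSet r N ω)

/-- The event that none of the first `k` balls contains `x`. -/
def avoidEvent (r : ℕ → ℝ) (k : ℕ) (x : ℝ) : Set (ℕ → ℝ) :=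
  {ω | ∀ n ∈ Finset.range k, ω n ∈ (ball x (r n))ᶜ}

/-- The probability that none of the first `k` balls contains `x`. -/
def avoidProb (μ : Measure ℝ) (r : ℕ → ℝ) (k : ℕ) (x : ℝ) : ℝ≥0∞ :=
  ∏ n ∈ Finset.range k, μ (ball x (r n))ᶜ

lemma msupport_eq_support (ν : Measure ℝ) : msupport ν = ν.support := by
  ext x
  rw [Measure.mem_support_iff_forall]
  constructor
  · intro h U hU
    obtain ⟨V, hVU, hV, hx⟩ := _root_.mem_nhds_iff.1 hU
    exact (h V hV hx).trans_le (measure_mono hVU)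
  · intro h U hU hx
    exact h U (hU.mem_nhds hx)

lemma map_update_iidLaw (μ : Measure ℝ) [IsProbabilityMeasure μ] (m : ℕ) :
    ((iidLaw μ).prod μ).map (fun p => Function.update p.1 m p.2) = iidLaw μ := by
  have hmeas : Measurable fun p : (ℕ → ℝ) × ℝ => Function.update p.1 m p.2 := by
    refine measurable_pi_lambda _ fun n => ?_
    by_cases h : n = m
    · subst h; simpa using measurable_snd
    · simp only [Function.update_of_ne h]; fun_prop
  refine Measure.eq_infinitePi _ fun s t ht => ?_
  rw [Measure.map_apply hmeas (.pi s.countable_toSet fun i _ => ht i)]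
  have : (fun p : (ℕ → ℝ) × ℝ => Function.update p.1 m p.2) ⁻¹' Set.pi s t =
      (Set.pi (s.erase m : Finset ℕ) t) ×ˢ (if m ∈ s then t m else univ) := by
    ext p
    simp only [mem_preimage, Set.mem_pi, Finset.mem_coe, mem_prod, Finset.mem_erase]
    constructor
    · refine fun h => ⟨fun i hi => by simpa [hi.1] using h i hi.2, ?_⟩
      split_ifs with hm
      · simpa using h m hm
      · trivial
    · rintro ⟨h1, h2⟩ i hi
      by_cases him : i = m
      · subst him; simpa [hi] using h2
      · simpa [him] using h1 i ⟨him, hi⟩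
  rw [this, Measure.prod_prod, Measure.infinitePi_pi _ (fun i _ => ht i)]
  split_ifs with hm
  · exact Finset.prod_erase_mul _ _ hm
  · rw [Finset.erase_eq_of_notMem hm]; simp

lemma lintegral_resample (μ : Measure ℝ) [IsProbabilityMeasure μ] (m : ℕ)
    {G : (ℕ → ℝ) → ℝ≥0∞} (hG : Measurable G) :
    ∫⁻ ω, G ω ∂(iidLaw μ) = ∫⁻ ω, ∫⁻ z, G (Function.update ω m z) ∂μ ∂(iidLaw μ) := by
  have hmeas : Measurable fun p : (ℕ → ℝ) × ℝ => Function.update p.1 m p.2 := by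
    refine measurable_pi_lambda _ fun n => ?_
    by_cases h : n = m
    · subst h; simpa using measurable_snd
    · simp only [Function.update_of_ne h]; fun_prop
  conv_lhs => rw [← map_update_iidLaw μ m]
  rw [lintegral_map hG hmeas]
  exact lintegral_prod _ (hG.comp hmeas).aemeasurable

lemma isClosed_setOf_mem_freeSet (r : ℕ → ℝ) (N : ℕ) :
    IsClosed {p : ℝ × (ℕ → ℝ) | p.1 ∈ freeSet r N p.2} := by
  have : {p : ℝ × (ℕ → ℝ) | p.1 ∈ freeSet r N p.2} =
      ⋂ n, ⋂ (_ : N ≤ n), {p : ℝ × (ℕ → ℝ) | r n ≤ dist p.1 (p.2 n)} := by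
    ext p; simp [freeSet]
  rw [this]
  exact isClosed_iInter fun n => isClosed_iInter fun _ =>
    isClosed_le continuous_const (by fun_prop)

lemma isClosed_freeSet (r : ℕ → ℝ) (N : ℕ) (ω : ℕ → ℝ) : IsClosed (freeSet r N ω) :=
  (isClosed_setOf_mem_freeSet r N).preimage (f := fun x : ℝ => (x, ω)) (by fun_prop)

lemma isClosed_missEvent (r : ℕ → ℝ) (N : ℕ) {S : Set ℝ} (hS : IsCompact S) :
    IsClosed (missEvent r N S) := by
  have : CompactSpace S := isCompact_iff_compactSpace.1 hS
  have h := isClosedMap_snd_of_compactSpace (X := S) (Y := ℕ → ℝ) _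
    ((isClosed_setOf_mem_freeSet r N).preimage
      (f := fun p : S × (ℕ → ℝ) => ((p.1 : ℝ), p.2)) (by fun_prop))
  convert h using 1
  ext ω
  simp [missEvent, Set.Nonempty]

lemma missEvent_mono (r : ℕ → ℝ) (N : ℕ) : Monotone (missEvent r N) :=
  fun _ _ h _ ⟨x, hx⟩ => ⟨x, h hx.1, hx.2⟩

lemma missEvent_iUnion (r : ℕ → ℝ) (N : ℕ) {ι : Sort*} (S : ι → Set ℝ) :
    missEvent r N (⋃ i, S i) = ⋃ i, missEvent r N (S i) := by
  ext ω
  simp only [missEvent, Set.Nonempty, mem_ofPred_eq, mem_inter_iff, mem_iUnion]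
  tauto

lemma measurableSet_missEvent (r : ℕ → ℝ) (N : ℕ) {S : Set ℝ} (hS : IsClosed S) :
    MeasurableSet (missEvent r N S) := by
  have : S = ⋃ n : ℕ, S ∩ closedBall 0 n := by
    rw [← inter_iUnion, iUnion_closedBall_nat, inter_univ]
  rw [this, missEvent_iUnion]
  exact .iUnion fun n =>
    (isClosed_missEvent r N ((isCompact_closedBall 0 _).inter_left hS)).measurableSet

lemma compl_subset_coverSet (r : ℕ → ℝ) (A : Set ℝ) :
    {ω | A ⊆ coverSet r ω}ᶜ ⊆ ⋃ N, missEvent r N A := by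
  intro ω hω
  simp only [mem_compl_iff, mem_ofPred_eq, Set.not_subset] at hω
  obtain ⟨x, hxA, hx⟩ := hω
  simp only [coverSet, mem_iInter, mem_iUnion, not_forall, not_exists] at hx
  obtain ⟨N, hN⟩ := hx
  exact mem_iUnion.2 ⟨N, x, hxA, fun n hn => hN n hn⟩

lemma exists_bounded_coordinates (P : Measure (ℕ → ℝ)) (r : ℕ → ℝ) (N : ℕ)
    (f : (ℕ → ℕ) → ℝ) {t : ℝ≥0∞} (ht : t < P (missEvent r N (range f))) :
    ∃ g : ℕ → ℕ, ∀ j, t < P (missEvent r N (f '' {α | ∀ i < j, α i ≤ g i})) := by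
  have step : ∀ (D : {D : Set (ℕ → ℕ) // t < P (missEvent r N (f '' D))}) (i : ℕ),
      ∃ n : ℕ, t < P (missEvent r N (f '' (D.1 ∩ {α | α i ≤ n}))) := by
    rintro ⟨D, hD⟩ i
    have hU : D = ⋃ n : ℕ, D ∩ {α : ℕ → ℕ | α i ≤ n} := by
      ext α
      simp only [mem_iUnion, mem_inter_iff, mem_ofPred_eq]
      exact ⟨fun h => ⟨α i, h, le_rfl⟩, fun ⟨_, h, _⟩ => h⟩
    have hm : Monotone fun n : ℕ => missEvent r N (f '' (D ∩ {α : ℕ → ℕ | α i ≤ n})) :=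
      fun a b hab => missEvent_mono r N (image_mono
        (inter_subset_inter_right _ fun α (hα : α i ≤ a) => hα.trans hab))
    rw [hU, image_iUnion, missEvent_iUnion, hm.measure_iUnion] at hD
    exact lt_iSup_iff.1 hD
  choose n hn using step
  let D : ℕ → {D : Set (ℕ → ℕ) // t < P (missEvent r N (f '' D))} :=
    fun j => Nat.rec ⟨univ, by rwa [image_univ]⟩ (fun i D => ⟨_, hn D i⟩) j
  refine ⟨fun j => n (D j) j, fun j => ?_⟩
  have : ∀ j, {α : ℕ → ℕ | ∀ i < j, α i ≤ n (D i) i} = (D j).1 := by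
    intro j
    induction j with
    | zero => simp [D]
    | succ j ih =>
      change _ = (D j).1 ∩ {α | α j ≤ n (D j) j}
      rw [← ih]
      ext α
      simp only [mem_inter_iff, mem_ofPred_eq, Nat.lt_succ_iff_lt_or_eq]
      exact ⟨fun h => ⟨fun i hi => h i (.inl hi), h j (.inr rfl)⟩,
        fun h i hi => hi.elim (h.1 i) (by rintro rfl; exact h.2)⟩
  rw [this]
  exact (D j).2

/-- The inner approximation by compact sets of the capacity `S ↦ P(S is not covered)`. -/
lemma exists_isCompact_missEvent_pos (P : Measure (ℕ → ℝ)) [IsFiniteMeasure P] (r : ℕ → ℝ) (N : ℕ)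
    {A : Set ℝ} (hA : MeasureTheory.AnalyticSet A) (hP : P (missEvent r N A) ≠ 0) :
    ∃ K ⊆ A, IsCompact K ∧ P (missEvent r N K) ≠ 0 := by
  rw [MeasureTheory.AnalyticSet] at hA
  obtain rfl | ⟨f, hf, rfl⟩ := hA
  · exact ⟨∅, Subset.rfl, isCompact_empty, hP⟩
  obtain ⟨t, ht0, ht⟩ := exists_between (pos_iff_ne_zero.2 hP)
  obtain ⟨g, hg⟩ := exists_bounded_coordinates P r N f ht
  have hL : IsCompact {α : ℕ → ℕ | ∀ i, α i ≤ g i} := by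
    have := isCompact_univ_pi fun i => (finite_Iic (g i)).isCompact
    convert this using 1
    ext α; simp [Pi.le_def]
  refine ⟨f '' {α | ∀ i, α i ≤ g i}, image_subset_range _ _, hL.image hf, ?_⟩
  let C : ℕ → Set (ℕ → ℕ) := fun j => {α | ∀ i < j, α i ≤ g i}
  have hanti : Antitone fun j => missEvent r N (closure (f '' C j)) := fun a b hab =>
    missEvent_mono r N (closure_mono (image_mono fun α hα i hi => hα i (hi.trans_le hab)))
  have hle : t ≤ P (⋂ j, missEvent r N (closure (f '' C j))) := by
    rw [hanti.measure_iInter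
      (fun j => (measurableSet_missEvent r N isClosed_closure).nullMeasurableSet)
      ⟨0, measure_ne_top _ _⟩]
    exact le_iInf fun j => (hg j).le.trans (measure_mono (missEvent_mono r N subset_closure))
  refine (ht0.trans_le (hle.trans (measure_mono fun ω hω => ?_))).ne'
  simp only [mem_iInter] at hω
  choose x hx hxF using hω
  have hy : ∀ j, ∃ β ∈ C j, dist (x j) (f β) < 1 / ((j : ℝ) + 1) := by
    intro j
    obtain ⟨_, ⟨β, hβ, rfl⟩, h⟩ := Metric.mem_closure_iff.1 (hx j) (1 / ((j : ℝ) + 1)) (by positivity)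
    exact ⟨β, hβ, h⟩
  choose β hβ hd using hy
  have hcpt : IsCompact (Set.pi univ fun i => Iic (g i + ∑ j ∈ Finset.range (i + 1), β j i)) :=
    isCompact_univ_pi fun i => (finite_Iic _).isCompact
  have hmem : ∀ j, β j ∈ Set.pi univ fun i => Iic (g i + ∑ j ∈ Finset.range (i + 1), β j i) := by
    intro j i _
    rw [mem_Iic]
    rcases lt_or_ge i j with h | h
    · exact (hβ j i h).trans (Nat.le_add_right _ _)
    · exact (Finset.single_le_sum (f := fun j => β j i) (fun _ _ => Nat.zero_le _)
        (Finset.mem_range.2 (Nat.lt_succ_of_le h))).trans (Nat.le_add_left _ _)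
  obtain ⟨b, -, φ, hφ, hb⟩ := hcpt.tendsto_subseq hmem
  refine ⟨f b, ⟨b, fun i => ?_, rfl⟩, ?_⟩
  · have h1 : Tendsto (fun j => β (φ j) i) atTop (𝓝 (b i)) :=
      ((continuous_apply i).tendsto b).comp hb
    refine le_of_tendsto h1 ?_
    filter_upwards [hφ.tendsto_atTop.eventually_gt_atTop i] with j hj
    exact hβ _ i hj
  · have h1 : Tendsto (fun j => f (β (φ j))) atTop (𝓝 (f b)) := (hf.tendsto b).comp hb
    have h2 : Tendsto (fun j => dist (f (β (φ j))) (x (φ j))) atTop (𝓝 0) :=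
      squeeze_zero (fun _ => dist_nonneg) (fun j => by rw [dist_comm]; exact (hd (φ j)).le)
        (tendsto_one_div_add_atTop_nhds_zero_nat.comp hφ.tendsto_atTop)
    have h3 : Tendsto (fun j => x (φ j)) atTop (𝓝 (f b)) := (tendsto_iff_of_dist h2).1 h1
    exact (isClosed_freeSet r N ω).mem_of_tendsto h3 (.of_forall fun j => hxF _)

lemma measurable_leftmostFree (r : ℕ → ℝ) (N : ℕ) {K : Set ℝ} (hK : IsCompact K) :
    Measurable (leftmostFree r N K) := by
  refine measurable_of_Iic fun a => ?_
  have key : ∀ ω, ω ∈ missEvent r N K →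
      (leftmostFree r N K ω ≤ a ↔ ω ∈ missEvent r N (K ∩ Iic a)) := by
    intro ω hω
    have hc : IsCompact (K ∩ freeSet r N ω) := hK.inter_right (isClosed_freeSet r N ω)
    constructor
    · intro h
      have := hc.sInf_mem hω
      exact ⟨_, ⟨this.1, h⟩, this.2⟩
    · rintro ⟨x, ⟨hxK, hxa⟩, hx⟩
      exact (csInf_le hc.bddBelow ⟨hxK, hx⟩).trans hxa
  have : leftmostFree r N K ⁻¹' Iic a = missEvent r N (K ∩ Iic a) ∪
      ((missEvent r N K)ᶜ ∩ {_ω | (0 : ℝ) ≤ a}) := by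
    ext ω
    by_cases hω : ω ∈ missEvent r N K
    · simp [key ω hω, hω]
    · have h1 : ω ∉ missEvent r N (K ∩ Iic a) := fun h =>
        hω (missEvent_mono r N inter_subset_left h)
      have h2 : leftmostFree r N K ω = 0 := by
        rw [leftmostFree, not_nonempty_iff_eq_empty.1 hω, Real.sInf_empty]
      simp [h1, h2, hω]
  rw [this]
  exact (measurableSet_missEvent r N (hK.isClosed.inter isClosed_Iic)).union
    ((measurableSet_missEvent r N hK.isClosed).compl.inter (.const _))

lemma leftmostFree_mem {r : ℕ → ℝ} {N : ℕ} {K : Set ℝ} (hK : IsCompact K) {ω : ℕ → ℝ}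
    (hω : ω ∈ missEvent r N K) : leftmostFree r N K ω ∈ K ∩ freeSet r N ω :=
  (hK.inter_right (isClosed_freeSet r N ω)).sInf_mem hω

/-- The function `φ` evaluated at the leftmost uncovered point of `K`, and zero if `K` is
covered. -/
def leftmostWeight (r : ℕ → ℝ) (N : ℕ) (K : Set ℝ) (φ : ℝ → ℝ≥0∞) (ω : ℕ → ℝ) : ℝ≥0∞ :=
  (missEvent r N K).indicator (fun ω => φ (leftmostFree r N K ω)) ω

lemma measurable_leftmostWeight (r : ℕ → ℝ) (N : ℕ) {K : Set ℝ} (hK : IsCompact K)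
    {φ : ℝ → ℝ≥0∞} (hφ : Measurable φ) : Measurable (leftmostWeight r N K φ) :=
  (hφ.comp (measurable_leftmostFree r N hK)).indicator (measurableSet_missEvent r N hK.isClosed)

/-- The conditional probability that the `n`-th ball misses `y`, given that it misses `x`. -/
def condAvoid (μ : Measure ℝ) (r : ℕ → ℝ) (y : ℝ) (n : ℕ) (x : ℝ) : ℝ≥0∞ :=
  μ ((ball x (r n))ᶜ ∩ (ball y (r n))ᶜ) * (μ (ball x (r n))ᶜ)⁻¹

lemma measurable_measure_compl_ball_inter (μ : Measure ℝ) [IsProbabilityMeasure μ] (ρ : ℝ) :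
    Measurable fun p : ℝ × ℝ => μ ((ball p.1 ρ)ᶜ ∩ (ball p.2 ρ)ᶜ) := by
  have h1 : MeasurableSet {q : (ℝ × ℝ) × ℝ | ρ ≤ dist q.2 q.1.1} :=
    measurableSet_le (by fun_prop) (by fun_prop)
  have h2 : MeasurableSet {q : (ℝ × ℝ) × ℝ | ρ ≤ dist q.2 q.1.2} :=
    measurableSet_le (by fun_prop) (by fun_prop)
  convert measurable_measure_prodMk_left (ν := μ) (h1.inter h2) using 3 with p
  ext z
  simp

lemma measurable_measure_compl_ball (μ : Measure ℝ) [IsProbabilityMeasure μ] (ρ : ℝ) :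
    Measurable fun x : ℝ => μ (ball x ρ)ᶜ := by
  simpa [Function.comp_def] using (measurable_measure_compl_ball_inter μ ρ).comp
    (measurable_id.prodMk measurable_id)

lemma measurable_condAvoid (μ : Measure ℝ) [IsProbabilityMeasure μ] (r : ℕ → ℝ) (y : ℝ) (n : ℕ) :
    Measurable (condAvoid μ r y n) :=
  ((measurable_measure_compl_ball_inter μ (r n)).comp (measurable_id.prodMk measurable_const)).mul
    (measurable_measure_compl_ball μ (r n)).inv

lemma condAvoid_le_one (μ : Measure ℝ) (r : ℕ → ℝ) (y : ℝ) (n : ℕ) (x : ℝ) :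
    condAvoid μ r y n x ≤ 1 := by
  refine (mul_le_mul_left (measure_mono inter_subset_left) _).trans ?_
  rw [← div_eq_mul_inv]
  exact ENNReal.div_self_le_one

lemma lintegral_leftmostWeight_update_le_of_lt (μ : Measure ℝ) [IsProbabilityMeasure μ]
    (r : ℕ → ℝ) {N m : ℕ} (hm : m < N) {K : Set ℝ} (hK : IsCompact K) {c : ℝ≥0∞}
    (hc : ∀ x ∈ K, (μ (ball x (r m))ᶜ)⁻¹ ≤ c) (y : ℝ) (φ : ℝ → ℝ≥0∞) (ω : ℕ → ℝ) :
    ∫⁻ z, leftmostWeight r N K (fun x => φ x * condAvoid μ r y m x) (Function.update ω m z) ∂μ ≤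
      c * ∫⁻ z, (ball y (r m))ᶜ.indicator 1 z *
        leftmostWeight r N K φ (Function.update ω m z) ∂μ := by
  have hfree : ∀ z, freeSet r N (Function.update ω m z) = freeSet r N ω := by
    intro z
    ext x
    refine forall₂_congr fun n hn => ?_
    rw [Function.update_of_ne (by lia)]
  have hmiss : ∀ z, Function.update ω m z ∈ missEvent r N K ↔ ω ∈ missEvent r N K := by
    intro z
    simp only [missEvent, mem_ofPred_eq, hfree]
  have hw : ∀ ψ z, leftmostWeight r N K ψ (Function.update ω m z) = leftmostWeight r N K ψ ω := by
    intro ψ z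
    by_cases h : ω ∈ missEvent r N K
    · rw [leftmostWeight, leftmostWeight, indicator_of_mem h, indicator_of_mem ((hmiss z).2 h),
        leftmostFree, leftmostFree, hfree]
    · rw [leftmostWeight, leftmostWeight, indicator_of_notMem h,
        indicator_of_notMem (mt (hmiss z).1 h)]
  simp only [hw]
  rw [lintegral_const, lintegral_mul_const _ (measurable_one.indicator measurableSet_ball.compl),
    lintegral_indicator_one measurableSet_ball.compl, measure_univ, mul_one]
  by_cases hω : ω ∈ missEvent r N K
  · simp only [leftmostWeight, indicator_of_mem hω]
    set t := leftmostFree r N K ω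
    have : condAvoid μ r y m t ≤ μ (ball y (r m))ᶜ * c :=
      mul_le_mul' (measure_mono inter_subset_right) (hc t (leftmostFree_mem hK hω).1)
    calc φ t * condAvoid μ r y m t ≤ φ t * (μ (ball y (r m))ᶜ * c) := by gcongr
      _ = _ := by ring
  · simp [leftmostWeight, hω]

lemma lintegral_leftmostWeight_update_le_of_le (μ : Measure ℝ) [IsProbabilityMeasure μ]
    (r : ℕ → ℝ) {N m : ℕ} (hm : N ≤ m) {K : Set ℝ} (hK : IsCompact K) (y : ℝ)
    {φ : ℝ → ℝ≥0∞} (hφ : ∀ x, y < x → φ x = 0) (ω : ℕ → ℝ) :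
    ∫⁻ z, leftmostWeight r N K (fun x => φ x * condAvoid μ r y m x) (Function.update ω m z) ∂μ ≤
      ∫⁻ z, (ball y (r m))ᶜ.indicator 1 z *
        leftmostWeight r N K φ (Function.update ω m z) ∂μ := by
  set G : Set ℝ := K ∩ ⋂ n, ⋂ (_ : N ≤ n ∧ n ≠ m), (ball (ω n) (r n))ᶜ with hGdef
  have hG : IsCompact G := hK.inter_right
    (isClosed_iInter fun n => isClosed_iInter fun _ => isOpen_ball.isClosed_compl)
  have hfree : ∀ z, K ∩ freeSet r N (Function.update ω m z) = G \ ball z (r m) := by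
    intro z
    ext x
    simp only [hGdef, freeSet, mem_inter_iff, mem_ofPred_eq, Set.mem_sdiff, mem_iInter, mem_compl_iff,
      and_assoc, and_congr_right_iff]
    intro _
    constructor
    · intro h
      exact ⟨fun n hn => by simpa [hn.2] using h n hn.1, by simpa using h m hm⟩
    · rintro ⟨h1, h2⟩ n hn
      by_cases hnm : n = m
      · subst hnm; simpa using h2
      · simpa [hnm] using h1 n ⟨hn, hnm⟩
  have hmiss : ∀ z, Function.update ω m z ∈ missEvent r N K ↔ (G \ ball z (r m)).Nonempty := by
    intro z
    rw [← hfree z]; rfl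
  rcases G.eq_empty_or_nonempty with hGe | hGne
  · have : ∀ ψ z, leftmostWeight r N K ψ (Function.update ω m z) = 0 := fun ψ z =>
      indicator_of_notMem (by rw [hmiss, hGe]; simp) _
    simp [this]
  set t := sInf G
  have ht : t ∈ G := hG.sInf_mem hGne
  have hout : ∀ ψ, ∀ z ∈ (ball t (r m))ᶜ,
      leftmostWeight r N K ψ (Function.update ω m z) = ψ t := by
    intro ψ z hz
    have htz : t ∈ G \ ball z (r m) := ⟨ht, by rwa [mem_ball_comm]⟩
    have : sInf (G \ ball z (r m)) = t :=
      le_antisymm (csInf_le (hG.bddBelow.mono sdiff_subset) htz)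
        (csInf_le_csInf hG.bddBelow ⟨t, htz⟩ sdiff_subset)
    rw [leftmostWeight, indicator_of_mem ((hmiss z).2 ⟨t, htz⟩), leftmostFree, hfree, this]
  rw [← lintegral_add_compl _ (measurableSet_ball (x := t) (ε := r m)),
    ← lintegral_add_compl (fun z => (ball y (r m))ᶜ.indicator 1 z * _)
      (measurableSet_ball (x := t) (ε := r m))]
  refine add_le_add (setLIntegral_mono' measurableSet_ball fun z hz => ?_) ?_
  · by_cases hne : (G \ ball z (r m)).Nonempty
    · have hmem : sInf (G \ ball z (r m)) ∈ G \ ball z (r m) :=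
        (hG.diff isOpen_ball).sInf_mem hne
      simp only [leftmostWeight, indicator_of_mem ((hmiss z).2 hne), leftmostFree, hfree]
      set u := sInf (G \ ball z (r m))
      rcases lt_or_ge y u with hyu | hyu
      · simp [hφ u hyu]
      · have htu : t ≤ u := csInf_le hG.bddBelow hmem.1
        have hu : r m ≤ |u - z| := by simpa [Real.dist_eq] using hmem.2
        have htz : |z - t| < r m := by simpa [Real.dist_eq] using hz
        have hzu : z + r m ≤ u := by
          rcases le_abs.1 hu with h | h
          · linarith
          · linarith [(abs_lt.1 htz).2]
        have hz' : z ∈ (ball y (r m))ᶜ := by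
          simp only [mem_compl_iff, mem_ball, Real.dist_eq, not_lt]
          rw [abs_sub_comm]
          exact le_trans (by linarith) (le_abs_self _)
        rw [indicator_of_mem hz', Pi.one_apply, one_mul]
        exact mul_le_of_le_one_right' (condAvoid_le_one μ r y m u)
    · rw [leftmostWeight, indicator_of_notMem (by rwa [hmiss])]
      exact zero_le
  · have hright : ∫⁻ z in (ball t (r m))ᶜ, (ball y (r m))ᶜ.indicator 1 z *
        leftmostWeight r N K φ (Function.update ω m z) ∂μ =
        ∫⁻ z in (ball t (r m))ᶜ, (ball y (r m))ᶜ.indicator 1 z * φ t ∂μ :=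
      setLIntegral_congr_fun measurableSet_ball.compl fun z hz => by
        simp only [hout φ z hz]
    rw [setLIntegral_congr_fun measurableSet_ball.compl (hout _), hright, setLIntegral_const,
      lintegral_mul_const _ (measurable_one.indicator measurableSet_ball.compl),
      lintegral_indicator_one measurableSet_ball.compl,
      Measure.restrict_apply measurableSet_ball.compl, condAvoid, inter_comm (ball y (r m))ᶜ]
    calc φ t * (μ ((ball t (r m))ᶜ ∩ (ball y (r m))ᶜ) * (μ (ball t (r m))ᶜ)⁻¹) *
          μ (ball t (r m))ᶜ
        = μ ((ball t (r m))ᶜ ∩ (ball y (r m))ᶜ) * φ t *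
          (μ (ball t (r m))ᶜ * (μ (ball t (r m))ᶜ)⁻¹) := by ring
      _ ≤ _ := mul_le_of_le_one_right' (by
        rw [← div_eq_mul_inv]; exact ENNReal.div_self_le_one)

lemma measurableSet_avoidEvent (r : ℕ → ℝ) (k : ℕ) (x : ℝ) :
    MeasurableSet (avoidEvent r k x) := by
  have : avoidEvent r k x = ⋂ n ∈ Finset.range k, (fun ω : ℕ → ℝ => ω n) ⁻¹' (ball x (r n))ᶜ := by
    ext ω; simp [avoidEvent]
  rw [this]
  exact Finset.measurableSet_biInter _ fun n _ => measurable_pi_apply n measurableSet_ball.compl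

lemma lintegral_leftmostWeight_prod_le (μ : Measure ℝ) [IsProbabilityMeasure μ]
    (r : ℕ → ℝ) (N : ℕ) {K : Set ℝ} (hK : IsCompact K) {c : ℝ≥0∞} (hctop : c ≠ ∞)
    (hc : ∀ m, ∀ x ∈ K, (μ (ball x (r m))ᶜ)⁻¹ ≤ c) (y : ℝ) (k : ℕ)
    {φ : ℝ → ℝ≥0∞} (hφm : Measurable φ) (hφ : ∀ x, y < x → φ x = 0) :
    ∫⁻ ω, leftmostWeight r N K (fun x => φ x * ∏ n ∈ Finset.range k, condAvoid μ r y n x) ω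
        ∂(iidLaw μ) ≤
      (∏ n ∈ Finset.range k, if n < N then c else 1) *
        ∫⁻ ω, (avoidEvent r k y).indicator 1 ω * leftmostWeight r N K φ ω ∂(iidLaw μ) := by
  induction k generalizing φ with
  | zero => simp [avoidEvent]
  | succ k ih =>
    have hφm' : Measurable fun x => φ x * condAvoid μ r y k x :=
      hφm.mul (measurable_condAvoid μ r y k)
    have h1 := ih hφm' fun x hx => by simp [hφ x hx]
    have hupd : ∀ ω z, Function.update ω k z ∈ avoidEvent r k y ↔ ω ∈ avoidEvent r k y := by
      intro ω z
      refine forall₂_congr fun n hn => ?_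
      rw [Function.update_of_ne (Finset.mem_range.1 hn).ne]
    have hind : ∀ ω z, (avoidEvent r k y).indicator (1 : (ℕ → ℝ) → ℝ≥0∞) (Function.update ω k z) =
        (avoidEvent r k y).indicator 1 ω := by
      intro ω z
      by_cases h : ω ∈ avoidEvent r k y
      · rw [indicator_of_mem h, indicator_of_mem ((hupd ω z).2 h), Pi.one_apply, Pi.one_apply]
      · rw [indicator_of_notMem h, indicator_of_notMem (mt (hupd ω z).1 h)]
    have hne : ∀ ω, (avoidEvent r k y).indicator (1 : (ℕ → ℝ) → ℝ≥0∞) ω ≠ ∞ := fun ω => by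
      by_cases h : ω ∈ avoidEvent r k y <;> simp [h]
    have hsucc : ∀ ω, (avoidEvent r (k + 1) y).indicator (1 : (ℕ → ℝ) → ℝ≥0∞) ω =
        (avoidEvent r k y).indicator 1 ω * (ball y (r k))ᶜ.indicator 1 (ω k) := by
      intro ω
      have : ω ∈ avoidEvent r (k + 1) y ↔ ω ∈ avoidEvent r k y ∧ ω k ∈ (ball y (r k))ᶜ := by
        simp only [avoidEvent, mem_ofPred_eq, Finset.range_add_one, Finset.forall_mem_insert]
        exact and_comm
      by_cases ha : ω ∈ avoidEvent r k y <;> by_cases hb : ω k ∈ (ball y (r k))ᶜ <;>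
        simp only [indicator, this, ha, hb] <;> simp
    have hindm : Measurable ((avoidEvent r k y).indicator (1 : (ℕ → ℝ) → ℝ≥0∞)) :=
      measurable_one.indicator (measurableSet_avoidEvent r k y)
    have hbm : Measurable fun ω : ℕ → ℝ => (ball y (r k))ᶜ.indicator (1 : ℝ → ℝ≥0∞) (ω k) :=
      (measurable_one.indicator measurableSet_ball.compl).comp (measurable_pi_apply k)
    have h2 : ∫⁻ ω, (avoidEvent r k y).indicator 1 ω *
          leftmostWeight r N K (fun x => φ x * condAvoid μ r y k x) ω ∂(iidLaw μ) ≤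
        (if k < N then c else 1) * ∫⁻ ω, (avoidEvent r (k + 1) y).indicator 1 ω *
          leftmostWeight r N K φ ω ∂(iidLaw μ) := by
      simp only [hsucc]
      rw [lintegral_resample μ k (G := fun ω => _ * leftmostWeight r N K _ ω)
          (hindm.mul (measurable_leftmostWeight r N hK hφm')),
        lintegral_resample μ k (G := fun ω => _ * _ * leftmostWeight r N K φ ω)
          ((hindm.mul hbm).mul (measurable_leftmostWeight r N hK hφm))]
      simp only [hind, Function.update_self, mul_assoc]
      simp only [lintegral_const_mul' _ _ (hne _)]
      have hconst : (if k < N then c else 1) ≠ ∞ := by split_ifs <;> simp [hctop]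
      rw [← lintegral_const_mul' _ _ hconst]
      refine lintegral_mono fun ω => ?_
      rw [mul_left_comm]
      refine mul_le_mul_right ?_ _
      split_ifs with hk
      · exact lintegral_leftmostWeight_update_le_of_lt μ r hk hK (hc k) y φ ω
      · rw [one_mul]
        exact lintegral_leftmostWeight_update_le_of_le μ r (not_lt.1 hk) hK y hφ ω
    calc _ = ∫⁻ ω, leftmostWeight r N K (fun x => φ x * condAvoid μ r y k x *
            ∏ n ∈ Finset.range k, condAvoid μ r y n x) ω ∂(iidLaw μ) := by
          congr! 4 with ω x
          rw [Finset.prod_range_succ]; ring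
      _ ≤ _ := h1
      _ ≤ _ := mul_le_mul_right h2 _
      _ = _ := by rw [Finset.prod_range_succ, mul_assoc]

/-- The probability that none of the first `k` balls contains `x` or `y`. -/
def pairAvoidProb (μ : Measure ℝ) (r : ℕ → ℝ) (k : ℕ) (x y : ℝ) : ℝ≥0∞ :=
  ∏ n ∈ Finset.range k, μ ((ball x (r n))ᶜ ∩ (ball y (r n))ᶜ)

lemma iidLaw_avoidEvent_inter (μ : Measure ℝ) [IsProbabilityMeasure μ] (r : ℕ → ℝ) (k : ℕ)
    (x y : ℝ) :
    iidLaw μ (avoidEvent r k x ∩ avoidEvent r k y) = pairAvoidProb μ r k x y := by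
  have : avoidEvent r k x ∩ avoidEvent r k y =
      Set.pi (Finset.range k) fun n => (ball x (r n))ᶜ ∩ (ball y (r n))ᶜ := by
    ext ω
    simp only [avoidEvent, mem_inter_iff, mem_ofPred_eq, Set.mem_pi, Finset.mem_coe]
    exact ⟨fun h n hn => ⟨h.1 n hn, h.2 n hn⟩, fun h => ⟨fun n hn => (h n hn).1,
      fun n hn => (h n hn).2⟩⟩
  rw [this, Measure.infinitePi_pi _ fun n _ =>
    measurableSet_ball.compl.inter measurableSet_ball.compl]
  rfl

lemma iidLaw_avoidEvent (μ : Measure ℝ) [IsProbabilityMeasure μ] (r : ℕ → ℝ) (k : ℕ) (x : ℝ) :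
    iidLaw μ (avoidEvent r k x) = avoidProb μ r k x := by
  have := iidLaw_avoidEvent_inter μ r k x x
  rw [inter_self] at this
  simpa only [pairAvoidProb, inter_self, avoidProb] using this

lemma avoidProb_ne_top (μ : Measure ℝ) [IsProbabilityMeasure μ] (r : ℕ → ℝ) (k : ℕ) (x : ℝ) :
    avoidProb μ r k x ≠ ∞ :=
  ENNReal.prod_ne_top fun _ _ => measure_ne_top _ _

lemma prod_inv_measure_compl_ball (μ : Measure ℝ) [IsProbabilityMeasure μ] (r : ℕ → ℝ) (k : ℕ)
    (x : ℝ) : ∏ n ∈ Finset.range k, (μ (ball x (r n))ᶜ)⁻¹ = (avoidProb μ r k x)⁻¹ :=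
  (ENNReal.prod_inv_distrib fun _ _ _ _ _ => .inr (measure_ne_top _ _)).symm

lemma prod_condAvoid (μ : Measure ℝ) [IsProbabilityMeasure μ] (r : ℕ → ℝ) (k : ℕ) (x y : ℝ) :
    ∏ n ∈ Finset.range k, condAvoid μ r y n x =
      pairAvoidProb μ r k x y * (avoidProb μ r k x)⁻¹ := by
  rw [← prod_inv_measure_compl_ball, pairAvoidProb, ← Finset.prod_mul_distrib]
  rfl

lemma measurable_avoidProb (μ : Measure ℝ) [IsProbabilityMeasure μ] (r : ℕ → ℝ) (k : ℕ) :
    Measurable (avoidProb μ r k) :=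
  Finset.measurable_fun_prod _ fun n _ => measurable_measure_compl_ball μ (r n)

lemma measurable_pairAvoidProb (μ : Measure ℝ) [IsProbabilityMeasure μ] (r : ℕ → ℝ) (k : ℕ) :
    Measurable fun p : ℝ × ℝ => pairAvoidProb μ r k p.1 p.2 :=
  Finset.measurable_fun_prod _ fun n _ => measurable_measure_compl_ball_inter μ (r n)

/-- The integrand of `Mart`, as an extended nonnegative number. -/
def avoidDensity (μ : Measure ℝ) (r : ℕ → ℝ) (k : ℕ) (x : ℝ) (ω : ℕ → ℝ) : ℝ≥0∞ :=
  (avoidEvent r k x).indicator 1 ω * (avoidProb μ r k x)⁻¹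

/-- The martingale `Mart`, as an extended nonnegative number. -/
def eMart (μ : Measure ℝ) (r : ℕ → ℝ) (ν : Measure ℝ) (k : ℕ) (ω : ℕ → ℝ) : ℝ≥0∞ :=
  ∫⁻ x, avoidDensity μ r k x ω ∂ν

lemma measurable_avoidDensity (μ : Measure ℝ) [IsProbabilityMeasure μ] (r : ℕ → ℝ) (k : ℕ) :
    Measurable fun p : ℝ × (ℕ → ℝ) => avoidDensity μ r k p.1 p.2 := by
  have h : MeasurableSet {p : ℝ × (ℕ → ℝ) | p.2 ∈ avoidEvent r k p.1} := by
    have : {p : ℝ × (ℕ → ℝ) | p.2 ∈ avoidEvent r k p.1} =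
        ⋂ n ∈ Finset.range k, {p : ℝ × (ℕ → ℝ) | r n ≤ dist (p.2 n) p.1} := by
      ext p; simp [avoidEvent]
    rw [this]
    exact Finset.measurableSet_biInter _ fun n _ => measurableSet_le (by fun_prop) (by fun_prop)
  exact (measurable_one.indicator h).mul ((measurable_avoidProb μ r k).comp measurable_fst).inv

lemma measurable_avoidDensity_comp (μ : Measure ℝ) [IsProbabilityMeasure μ] (r : ℕ → ℝ) (k : ℕ)
    {α : Type*} [MeasurableSpace α] {f : α → ℝ} {g : α → ℕ → ℝ} (hf : Measurable f)
    (hg : Measurable g) : Measurable fun a => avoidDensity μ r k (f a) (g a) := by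
  have h := (measurable_avoidDensity μ r k).comp (hf.prodMk hg)
  exact h

lemma measurable_eMart (μ : Measure ℝ) [IsProbabilityMeasure μ] (r : ℕ → ℝ) (ν : Measure ℝ)
    [SFinite ν] (k : ℕ) : Measurable (eMart μ r ν k) :=
  Measurable.lintegral_prod_left' (measurable_avoidDensity μ r k)

lemma lintegral_avoidDensity_mul (μ : Measure ℝ) [IsProbabilityMeasure μ] (r : ℕ → ℝ) (k : ℕ)
    (x y : ℝ) :
    ∫⁻ ω, avoidDensity μ r k x ω * avoidDensity μ r k y ω ∂(iidLaw μ) =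
      pairAvoidProb μ r k x y * (avoidProb μ r k x)⁻¹ * (avoidProb μ r k y)⁻¹ := by
  have hm := (measurableSet_avoidEvent r k x).inter (measurableSet_avoidEvent r k y)
  have : ∀ ω, avoidDensity μ r k x ω * avoidDensity μ r k y ω =
      (avoidEvent r k x ∩ avoidEvent r k y).indicator 1 ω *
        ((avoidProb μ r k x)⁻¹ * (avoidProb μ r k y)⁻¹) := by
    intro ω
    rw [inter_indicator_one, avoidDensity, avoidDensity, Pi.mul_apply]
    ring
  simp only [this]
  rw [lintegral_mul_const _ (measurable_one.indicator hm), lintegral_indicator_one hm,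
    iidLaw_avoidEvent_inter, mul_assoc]

lemma lintegral_eMart (μ : Measure ℝ) [IsProbabilityMeasure μ] (r : ℕ → ℝ) (ν : Measure ℝ)
    [IsProbabilityMeasure ν] (k : ℕ) (hν : ∀ᵐ x ∂ν, avoidProb μ r k x ≠ 0) :
    ∫⁻ ω, eMart μ r ν k ω ∂(iidLaw μ) = 1 := by
  simp only [eMart]
  rw [lintegral_lintegral_swap (f := fun ω x => avoidDensity μ r k x ω)
    (measurable_avoidDensity_comp μ r k measurable_snd measurable_fst).aemeasurable]
  have : ∀ᵐ x ∂ν, ∫⁻ ω, avoidDensity μ r k x ω ∂(iidLaw μ) = 1 := by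
    filter_upwards [hν] with x hx
    simp only [avoidDensity]
    rw [lintegral_mul_const _ (measurable_one.indicator (measurableSet_avoidEvent r k x)),
      lintegral_indicator_one (measurableSet_avoidEvent r k x), iidLaw_avoidEvent,
      ENNReal.mul_inv_cancel hx (avoidProb_ne_top μ r k x)]
  rw [lintegral_congr_ae this]
  simp

lemma eMart_sq (μ : Measure ℝ) [IsProbabilityMeasure μ] (r : ℕ → ℝ) (ν : Measure ℝ) (k : ℕ)
    (ω : ℕ → ℝ) :
    eMart μ r ν k ω ^ 2 = ∫⁻ y, ∫⁻ x, avoidDensity μ r k x ω * avoidDensity μ r k y ω ∂ν ∂ν := by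
  have hx : Measurable fun x => avoidDensity μ r k x ω :=
    measurable_avoidDensity_comp μ r k measurable_id measurable_const
  simp only [lintegral_mul_const _ hx]
  rw [lintegral_const_mul _ hx, sq, eMart]

lemma lintegral_eMart_sq (μ : Measure ℝ) [IsProbabilityMeasure μ] (r : ℕ → ℝ) (ν : Measure ℝ)
    [IsProbabilityMeasure ν] (k : ℕ) :
    ∫⁻ ω, eMart μ r ν k ω ^ 2 ∂(iidLaw μ) =
      ∫⁻ y, ∫⁻ x, pairAvoidProb μ r k x y * (avoidProb μ r k x)⁻¹ * (avoidProb μ r k y)⁻¹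
        ∂ν ∂ν := by
  have hm : Measurable fun q : ((ℕ → ℝ) × ℝ) × ℝ =>
      avoidDensity μ r k q.2 q.1.1 * avoidDensity μ r k q.1.2 q.1.1 :=
    (measurable_avoidDensity_comp μ r k measurable_snd (measurable_fst.comp measurable_fst)).mul
      (measurable_avoidDensity_comp μ r k (measurable_snd.comp measurable_fst)
        (measurable_fst.comp measurable_fst))
  have hm1 : Measurable fun p : (ℕ → ℝ) × ℝ =>
      ∫⁻ x, avoidDensity μ r k x p.1 * avoidDensity μ r k p.2 p.1 ∂ν := hm.lintegral_prod_right'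
  have hm2 (y : ℝ) : Measurable fun p : (ℕ → ℝ) × ℝ =>
      avoidDensity μ r k p.2 p.1 * avoidDensity μ r k y p.1 :=
    (measurable_avoidDensity_comp μ r k measurable_snd measurable_fst).mul
      (measurable_avoidDensity_comp μ r k measurable_const measurable_fst)
  calc ∫⁻ ω, eMart μ r ν k ω ^ 2 ∂(iidLaw μ)
      = ∫⁻ ω, ∫⁻ y, ∫⁻ x, avoidDensity μ r k x ω * avoidDensity μ r k y ω ∂ν ∂ν ∂(iidLaw μ) :=
        lintegral_congr fun ω => eMart_sq μ r ν k ω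
    _ = ∫⁻ y, ∫⁻ ω, ∫⁻ x, avoidDensity μ r k x ω * avoidDensity μ r k y ω ∂ν ∂(iidLaw μ) ∂ν :=
        lintegral_lintegral_swap
          (f := fun ω y => ∫⁻ x, avoidDensity μ r k x ω * avoidDensity μ r k y ω ∂ν)
          hm1.aemeasurable
    _ = ∫⁻ y, ∫⁻ x, ∫⁻ ω, avoidDensity μ r k x ω * avoidDensity μ r k y ω ∂(iidLaw μ) ∂ν ∂ν :=
        lintegral_congr fun y => lintegral_lintegral_swap
          (f := fun ω x => avoidDensity μ r k x ω * avoidDensity μ r k y ω) (hm2 y).aemeasurable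
    _ = _ := lintegral_congr fun y => lintegral_congr fun x => lintegral_avoidDensity_mul μ r k x y

lemma lintegral_energy_le (μ : Measure ℝ) [IsProbabilityMeasure μ] (r : ℕ → ℝ) (ν : Measure ℝ)
    [IsProbabilityMeasure ν] (k : ℕ) {b : ℝ≥0∞}
    (hb : ∀ y, ∫⁻ x, (Iic y).indicator 1 x *
      (pairAvoidProb μ r k x y * (avoidProb μ r k x)⁻¹) ∂ν ≤ b * avoidProb μ r k y) :
    ∫⁻ y, ∫⁻ x, pairAvoidProb μ r k x y * (avoidProb μ r k x)⁻¹ * (avoidProb μ r k y)⁻¹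
      ∂ν ∂ν ≤ 2 * b := by
  set E : ℝ → ℝ → ℝ≥0∞ := fun x y =>
    pairAvoidProb μ r k x y * (avoidProb μ r k x)⁻¹ * (avoidProb μ r k y)⁻¹ with hE
  have hEm : Measurable fun p : ℝ × ℝ => E p.1 p.2 :=
    ((measurable_pairAvoidProb μ r k).mul ((measurable_avoidProb μ r k).comp measurable_fst).inv).mul
      ((measurable_avoidProb μ r k).comp measurable_snd).inv
  have hle : MeasurableSet {p : ℝ × ℝ | p.1 ≤ p.2} := measurableSet_le measurable_fst measurable_snd
  have hFm : Measurable fun p : ℝ × ℝ => (Iic p.2).indicator 1 p.1 * E p.1 p.2 :=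
    (measurable_one.indicator hle).mul hEm
  have hsymm : ∀ x y, E x y = E y x := by
    intro x y
    simp only [hE, pairAvoidProb]
    rw [mul_right_comm]
    simp only [inter_comm]
  have hhalf : ∫⁻ y, ∫⁻ x, (Iic y).indicator 1 x * E x y ∂ν ∂ν ≤ b := by
    calc ∫⁻ y, ∫⁻ x, (Iic y).indicator 1 x * E x y ∂ν ∂ν
        ≤ ∫⁻ _y, b ∂ν := by
          refine lintegral_mono fun y => ?_
          have hmx : Measurable fun x : ℝ => (Iic y).indicator 1 x *
              (pairAvoidProb μ r k x y * (avoidProb μ r k x)⁻¹) :=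
            (measurable_one.indicator measurableSet_Iic).mul
              (((measurable_pairAvoidProb μ r k).comp measurable_prodMk_right).mul
                (measurable_avoidProb μ r k).inv)
          simp only [hE, ← mul_assoc]
          simp only [← mul_assoc] at hmx hb
          rw [lintegral_mul_const _ hmx]
          calc _ ≤ b * avoidProb μ r k y * (avoidProb μ r k y)⁻¹ := mul_le_mul_left (hb y) _
            _ ≤ b := by
              rw [mul_assoc, ← div_eq_mul_inv]
              exact mul_le_of_le_one_right' ENNReal.div_self_le_one
      _ = b := by simp
  calc ∫⁻ y, ∫⁻ x, E x y ∂ν ∂ν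
      ≤ ∫⁻ y, ((∫⁻ x, (Iic y).indicator 1 x * E x y ∂ν) +
          ∫⁻ x, (Iic x).indicator 1 y * E y x ∂ν) ∂ν := by
        refine lintegral_mono fun y => ?_
        have hx : Measurable fun x : ℝ => (Iic y).indicator (1 : ℝ → ℝ≥0∞) x * E x y :=
          hFm.comp measurable_prodMk_right
        rw [← lintegral_add_left hx]
        refine lintegral_mono fun x => ?_
        rw [hsymm y x]
        rcases le_total x y with h | h
        · simp [indicator, h]
        · simp [indicator, h]
    _ = (∫⁻ y, ∫⁻ x, (Iic y).indicator 1 x * E x y ∂ν ∂ν) +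
          ∫⁻ y, ∫⁻ x, (Iic x).indicator 1 y * E y x ∂ν ∂ν :=
        lintegral_add_left (Measurable.lintegral_prod_left' hFm) _
    _ = (∫⁻ y, ∫⁻ x, (Iic y).indicator 1 x * E x y ∂ν ∂ν) +
          ∫⁻ x, ∫⁻ y, (Iic x).indicator 1 y * E y x ∂ν ∂ν := by
        rw [lintegral_lintegral_swap (f := fun y x => (Iic x).indicator 1 y * E y x)
          hFm.aemeasurable]
    _ ≤ 2 * b := by rw [two_mul]; exact add_le_add hhalf hhalf

lemma exists_measure_lintegral_eMart_sq_le (μ : Measure ℝ) [IsProbabilityMeasure μ] (r : ℕ → ℝ)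
    (N : ℕ) {K : Set ℝ} (hK : IsCompact K) {c : ℝ≥0∞} (hctop : c ≠ ∞)
    (hc : ∀ m, ∀ x ∈ K, (μ (ball x (r m))ᶜ)⁻¹ ≤ c) (hpos : iidLaw μ (missEvent r N K) ≠ 0) :
    ∃ ν : Measure ℝ, IsProbabilityMeasure ν ∧ ν Kᶜ = 0 ∧ ∃ C : ℝ≥0∞, C ≠ ∞ ∧
      ∀ k, ∫⁻ ω, eMart μ r ν k ω ^ 2 ∂(iidLaw μ) ≤ C := by
  set p := iidLaw μ (missEvent r N K) with hp
  have hptop : p ≠ ∞ := measure_ne_top _ _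
  have hmeas := measurable_leftmostFree r N hK
  have hmiss := measurableSet_missEvent r N hK.isClosed
  set ν : Measure ℝ := p⁻¹ • ((iidLaw μ).restrict (missEvent r N K)).map (leftmostFree r N K)
  have hν : ∀ g : ℝ → ℝ≥0∞, Measurable g →
      ∫⁻ x, g x ∂ν = p⁻¹ * ∫⁻ ω, leftmostWeight r N K g ω ∂(iidLaw μ) := by
    intro g hg
    simp only [ν]
    rw [lintegral_smul_measure, lintegral_map hg hmeas, smul_eq_mul]
    congr 1
    exact (lintegral_indicator hmiss _).symm
  have hprob : IsProbabilityMeasure ν := ⟨by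
    simp [ν, Measure.map_apply hmeas, ← hp, ENNReal.inv_mul_cancel hpos hptop]⟩
  refine ⟨ν, hprob, ?_, 2 * (p⁻¹ * (max 1 c) ^ N), ?_, fun k => ?_⟩
  · have : (iidLaw μ).restrict (missEvent r N K) (leftmostFree r N K ⁻¹' Kᶜ) = 0 := by
      rw [Measure.restrict_apply (hmeas hK.measurableSet.compl)]
      convert measure_empty (μ := iidLaw μ)
      ext ω
      simp only [mem_inter_iff, mem_preimage, mem_compl_iff, mem_empty_iff_false, iff_false,
        not_and]
      exact fun h hω => h (leftmostFree_mem hK hω).1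
    simp only [ν, Measure.smul_apply, Measure.map_apply hmeas hK.measurableSet.compl, this,
      smul_zero]
  · exact ENNReal.mul_ne_top (by simp) (ENNReal.mul_ne_top (ENNReal.inv_ne_top.2 hpos)
      (ENNReal.pow_ne_top (by simp [hctop])))
  rw [lintegral_eMart_sq]
  refine lintegral_energy_le μ r ν k fun y => ?_
  have hφ : Measurable ((Iic y).indicator (1 : ℝ → ℝ≥0∞)) :=
    measurable_one.indicator measurableSet_Iic
  have hg : Measurable fun x : ℝ => (Iic y).indicator (1 : ℝ → ℝ≥0∞) x *
      (pairAvoidProb μ r k x y * (avoidProb μ r k x)⁻¹) :=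
    hφ.mul (((measurable_pairAvoidProb μ r k).comp measurable_prodMk_right).mul
      (measurable_avoidProb μ r k).inv)
  rw [hν _ hg, mul_assoc]
  refine mul_le_mul_right ?_ _
  simp only [← prod_condAvoid]
  refine (lintegral_leftmostWeight_prod_le μ r N hK hctop hc y k hφ
    fun x hx => by simp [hx]).trans (mul_le_mul' ?_ ?_)
  · calc (∏ n ∈ Finset.range k, if n < N then c else 1)
        ≤ ∏ n ∈ Finset.range k, if n < N then max 1 c else 1 := by
          refine Finset.prod_le_prod' fun n _ => ?_
          split_ifs <;> simp
      _ = max 1 c ^ (Finset.card {n ∈ Finset.range k | n < N}) := by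
          rw [← Finset.prod_filter, Finset.prod_const]
      _ ≤ max 1 c ^ N := by
          refine pow_le_pow_right₀ (le_max_left _ _) ?_
          calc _ ≤ (Finset.range N).card := Finset.card_le_card fun n hn => by
                simpa using (Finset.mem_filter.1 hn).2
            _ = N := Finset.card_range N
  · calc _ ≤ ∫⁻ ω, (avoidEvent r k y).indicator 1 ω ∂(iidLaw μ) := by
          refine lintegral_mono fun ω => mul_le_of_le_one_right' ?_
          refine indicator_le_self' (fun _ _ => zero_le) ω |>.trans ?_
          exact indicator_le_self' (f := (1 : ℝ → ℝ≥0∞)) (fun _ _ => zero_le) _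
      _ = _ := by
          rw [lintegral_indicator_one (measurableSet_avoidEvent r k y), iidLaw_avoidEvent]

lemma prod_eq_toReal_avoidDensity (μ : Measure ℝ) [IsProbabilityMeasure μ] (r : ℕ → ℝ) (k : ℕ)
    (x : ℝ) (ω : ℕ → ℝ) :
    ∏ n ∈ Finset.range k, (1 - Set.indicator (ball (ω n) (r n)) (fun _ => (1 : ℝ)) x) /
      (1 - (μ (ball x (r n))).toReal) = (avoidDensity μ r k x ω).toReal := by
  have hcompl : ∀ n, 1 - (μ (ball x (r n))).toReal = (μ (ball x (r n))ᶜ).toReal := fun n => by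
    rw [prob_compl_eq_one_sub measurableSet_ball, ENNReal.toReal_sub_of_le prob_le_one (by simp),
      ENNReal.toReal_one]
  simp only [hcompl, avoidDensity, ENNReal.toReal_mul, ENNReal.toReal_inv, avoidProb,
    ENNReal.toReal_prod, div_eq_mul_inv, Finset.prod_mul_distrib,
    Finset.prod_inv_distrib]
  congr 1
  by_cases h : ω ∈ avoidEvent r k x
  · rw [indicator_of_mem h, Finset.prod_eq_one]
    · simp
    intro n hn
    rw [indicator_of_notMem, sub_zero]
    rw [mem_ball_comm]
    exact h n hn
  · rw [indicator_of_notMem h, ENNReal.toReal_zero]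
    simp only [avoidEvent, mem_ofPred_eq, not_forall, mem_compl_iff, not_not] at h
    obtain ⟨n, hn, h⟩ := h
    refine Finset.prod_eq_zero hn ?_
    rw [indicator_of_mem (mem_ball_comm.1 h), sub_self]

lemma Mart_eq_integral (μ : Measure ℝ) [IsProbabilityMeasure μ] (r : ℕ → ℝ) (ν : Measure ℝ)
    (k : ℕ) (ω : ℕ → ℝ) : Mart μ r ν k ω = ∫ x, (avoidDensity μ r k x ω).toReal ∂ν := by
  simp only [Mart, prod_eq_toReal_avoidDensity]

lemma avoidDensity_le (μ : Measure ℝ) (r : ℕ → ℝ) (k : ℕ) (x : ℝ) (ω : ℕ → ℝ) :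
    avoidDensity μ r k x ω ≤ (avoidProb μ r k x)⁻¹ :=
  mul_le_of_le_one_left' (indicator_le_self' (fun _ _ => zero_le) ω)

lemma avoidDensity_le_pow (μ : Measure ℝ) [IsProbabilityMeasure μ] (r : ℕ → ℝ) (k : ℕ)
    {c : ℝ≥0∞} {x : ℝ} (hc : ∀ n, (μ (ball x (r n))ᶜ)⁻¹ ≤ c) (ω : ℕ → ℝ) :
    avoidDensity μ r k x ω ≤ c ^ k := by
  refine (avoidDensity_le μ r k x ω).trans ?_
  rw [← prod_inv_measure_compl_ball]
  simpa using Finset.prod_le_pow_card (Finset.range k) _ c fun n _ => hc n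

lemma eMart_le_pow (μ : Measure ℝ) [IsProbabilityMeasure μ] (r : ℕ → ℝ) (ν : Measure ℝ)
    [IsProbabilityMeasure ν] (k : ℕ) {c : ℝ≥0∞}
    (hc : ∀ᵐ x ∂ν, ∀ n, (μ (ball x (r n))ᶜ)⁻¹ ≤ c) (ω : ℕ → ℝ) :
    eMart μ r ν k ω ≤ c ^ k := by
  calc eMart μ r ν k ω ≤ ∫⁻ _, c ^ k ∂ν := by
        refine lintegral_mono_ae ?_
        filter_upwards [hc] with x hx using avoidDensity_le_pow μ r k hx ω
    _ = c ^ k := by simp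

lemma Mart_eq_toReal_eMart (μ : Measure ℝ) [IsProbabilityMeasure μ] (r : ℕ → ℝ) (ν : Measure ℝ)
    (k : ℕ) {c : ℝ≥0∞} (hctop : c ≠ ∞)
    (hc : ∀ᵐ x ∂ν, ∀ n, (μ (ball x (r n))ᶜ)⁻¹ ≤ c) (ω : ℕ → ℝ) :
    Mart μ r ν k ω = (eMart μ r ν k ω).toReal := by
  rw [Mart_eq_integral, eMart]
  refine integral_toReal
    (measurable_avoidDensity_comp μ r k measurable_id measurable_const).aemeasurable ?_
  filter_upwards [hc] with x hx
  exact (avoidDensity_le_pow μ r k hx ω).trans_lt (ENNReal.pow_lt_top hctop.lt_top)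

lemma integral_Mart_sq (μ : Measure ℝ) [IsProbabilityMeasure μ] (r : ℕ → ℝ) (ν : Measure ℝ)
    [IsProbabilityMeasure ν] (k : ℕ) {c : ℝ≥0∞} (hctop : c ≠ ∞)
    (hc : ∀ᵐ x ∂ν, ∀ n, (μ (ball x (r n))ᶜ)⁻¹ ≤ c) :
    ∫ ω, Mart μ r ν k ω ^ 2 ∂(iidLaw μ) =
      (∫⁻ ω, eMart μ r ν k ω ^ 2 ∂(iidLaw μ)).toReal := by
  simp only [Mart_eq_toReal_eMart μ r ν k hctop hc, ← ENNReal.toReal_pow]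
  exact integral_toReal ((measurable_eMart μ r ν k).pow_const 2).aemeasurable
    (.of_forall fun ω => ENNReal.pow_lt_top ((eMart_le_pow μ r ν k hc ω).trans_lt
      (ENNReal.pow_lt_top hctop.lt_top)))

lemma lintegral_eMart_sq_lt_top (μ : Measure ℝ) [IsProbabilityMeasure μ] (r : ℕ → ℝ) (ν : Measure ℝ)
    [IsProbabilityMeasure ν] (k : ℕ) {c : ℝ≥0∞} (hctop : c ≠ ∞)
    (hc : ∀ᵐ x ∂ν, ∀ n, (μ (ball x (r n))ᶜ)⁻¹ ≤ c) :
    ∫⁻ ω, eMart μ r ν k ω ^ 2 ∂(iidLaw μ) < ∞ := by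
  calc ∫⁻ ω, eMart μ r ν k ω ^ 2 ∂(iidLaw μ) ≤ ∫⁻ _, (c ^ k) ^ 2 ∂(iidLaw μ) := by
        exact lintegral_mono fun ω => pow_le_pow_left₀ zero_le (eMart_le_pow μ r ν k hc ω) 2
    _ = (c ^ k) ^ 2 := by simp
    _ < ∞ := ENNReal.pow_lt_top (ENNReal.pow_lt_top hctop.lt_top)

lemma inv_measure_compl_ball_le (μ : Measure ℝ) [IsProbabilityMeasure μ] {r : ℕ → ℝ}
    (hmono : Antitone r) {x : ℝ} (hx : x ∈ msupport μ) (n : ℕ) :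
    (μ (ball x (r n))ᶜ)⁻¹ ≤ (1 - ⨆ x ∈ msupport μ, μ (ball x (r 0)))⁻¹ := by
  rw [prob_compl_eq_one_sub measurableSet_ball]
  gcongr
  exact (measure_mono (ball_subset_ball (hmono n.zero_le))).trans
    (le_iSup₂ (f := fun x _ => μ (ball x (r 0))) x hx)

lemma exists_measure_ball_eq_zero {μ : Measure ℝ} {r : ℕ → ℝ} (hlim : Tendsto r atTop (𝓝 0))
    {x : ℝ} (hx : x ∉ msupport μ) : ∃ N, ∀ n, N ≤ n → μ (ball x (r n)) = 0 := by
  simp only [msupport, mem_ofPred_eq, not_forall, not_lt, nonpos_iff_eq_zero] at hx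
  obtain ⟨U, hU, hxU, hμU⟩ := hx
  obtain ⟨ε, hε, hεU⟩ := Metric.isOpen_iff.1 hU x hxU
  obtain ⟨N, hN⟩ := eventually_atTop.1 (hlim.eventually (gt_mem_nhds hε))
  exact ⟨N, fun n hn => measure_mono_null ((ball_subset_ball (hN n hn).le).trans hεU) hμU⟩

lemma iidLaw_subset_coverSet_eq_zero {μ : Measure ℝ} [IsProbabilityMeasure μ] {r : ℕ → ℝ}
    (hlim : Tendsto r atTop (𝓝 0)) {A : Set ℝ} {x : ℝ} (hxA : x ∈ A) (hx : x ∉ msupport μ) :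
    iidLaw μ {ω | A ⊆ coverSet r ω} = 0 := by
  obtain ⟨N, hN⟩ := exists_measure_ball_eq_zero hlim hx
  have hsub : {ω | A ⊆ coverSet r ω} ⊆ ⋃ n, ⋃ (_ : N ≤ n), {ω | ω n ∈ ball x (r n)} := by
    intro ω hω
    have h := mem_iInter.1 (hω hxA) N
    simp only [mem_iUnion] at h ⊢
    obtain ⟨n, hn, h⟩ := h
    exact ⟨n, hn, mem_ball_comm.1 h⟩
  refine measure_mono_null hsub (measure_iUnion_null fun n => measure_iUnion_null fun hn => ?_)
  have := (measurePreserving_eval_infinitePi (fun _ : ℕ => μ) n).measure_preimage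
    (measurableSet_ball (x := x) (ε := r n)).nullMeasurableSet
  rw [hN n hn] at this
  exact this

lemma exists_bound_integral_Mart_sq_dirac (μ : Measure ℝ) [IsProbabilityMeasure μ] {r : ℕ → ℝ}
    (hlim : Tendsto r atTop (𝓝 0)) {x : ℝ} (hx : x ∉ msupport μ) :
    ∃ C : ℝ, ∀ k, ∫ ω, Mart μ r (Measure.dirac x) k ω ^ 2 ∂(iidLaw μ) ≤ C := by
  obtain ⟨N, hN⟩ := exists_measure_ball_eq_zero hlim hx
  have hstab : ∀ k, avoidProb μ r k x = avoidProb μ r (min k N) x := by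
    intro k
    refine (Finset.prod_subset (Finset.range_subset_range.2 (min_le_left k N))
      fun n hn hn' => ?_).symm
    rw [prob_compl_eq_one_sub measurableSet_ball, hN n, tsub_zero]
    simp only [Finset.mem_range, lt_min_iff, not_and, not_lt] at hn hn'
    exact hn' hn
  set B : ℝ := ∑ k ∈ Finset.range (N + 1), ((avoidProb μ r k x)⁻¹).toReal
  have hB : ∀ k, ((avoidProb μ r k x)⁻¹).toReal ≤ B := fun k => by
    rw [hstab]
    exact Finset.single_le_sum (f := fun k => ((avoidProb μ r k x)⁻¹).toReal)
      (fun _ _ => ENNReal.toReal_nonneg)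
      (Finset.mem_range.2 (Nat.lt_succ_of_le (min_le_right k N)))
  refine ⟨B ^ 2, fun k => ?_⟩
  have hle : ∀ ω, Mart μ r (Measure.dirac x) k ω ^ 2 ≤ B ^ 2 := fun ω => by
    rw [Mart_eq_integral, integral_dirac]
    refine pow_le_pow_left₀ ENNReal.toReal_nonneg (le_trans ?_ (hB k)) 2
    rw [avoidDensity, ENNReal.toReal_mul]
    refine mul_le_of_le_one_left ENNReal.toReal_nonneg ?_
    by_cases h : ω ∈ avoidEvent r k x <;> simp [h]
  calc ∫ ω, Mart μ r (Measure.dirac x) k ω ^ 2 ∂(iidLaw μ)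
      ≤ ∫ _, B ^ 2 ∂(iidLaw μ) := integral_mono_of_nonneg (.of_forall fun _ => sq_nonneg _)
        (integrable_const _) (.of_forall hle)
    _ = B ^ 2 := by simp

lemma msupport_dirac (x : ℝ) : msupport (Measure.dirac x) = {x} := by
  ext y
  simp only [msupport, mem_ofPred_eq, mem_singleton_iff]
  constructor
  · intro h
    by_contra hne
    have := h {x}ᶜ isOpen_compl_singleton hne
    simp at this
  · rintro rfl U hU hy
    simp [Measure.dirac_apply' _ hU.measurableSet, hy]

/-- The event that the first `k` balls cover `S`. -/
def coverEvent (r : ℕ → ℝ) (S : Set ℝ) (k : ℕ) : Set (ℕ → ℝ) :=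
  {ω | S ⊆ ⋃ n ∈ Finset.range k, ball (ω n) (r n)}

lemma monotone_coverEvent (r : ℕ → ℝ) (S : Set ℝ) : Monotone (coverEvent r S) :=
  fun _ _ h _ hω => hω.trans (biUnion_subset_biUnion_left fun _ hn =>
    Finset.range_subset_range.2 h hn)

lemma setOf_subset_coverSet_subset (r : ℕ → ℝ) {A S : Set ℝ} (hS : IsCompact S) (hSA : S ⊆ A) :
    {ω | A ⊆ coverSet r ω} ⊆ ⋃ k, coverEvent r S k := by
  intro ω hω
  have hcov : S ⊆ ⋃ n, ball (ω n) (r n) := fun x hx => by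
    have h := mem_iInter.1 (hω (hSA hx)) 0
    simp only [mem_iUnion] at h ⊢
    obtain ⟨n, -, h⟩ := h
    exact ⟨n, h⟩
  obtain ⟨t, ht⟩ := hS.elim_finite_subcover _ (fun n => isOpen_ball) hcov
  refine mem_iUnion.2 ⟨t.sup id + 1, ht.trans (biUnion_subset_biUnion_left fun n hn => ?_)⟩
  exact Finset.mem_range.2 (Nat.lt_succ_of_le (Finset.le_sup (f := id) hn))

lemma eMart_eq_zero_of_mem_coverEvent (μ : Measure ℝ) (r : ℕ → ℝ) {ν : Measure ℝ} {S : Set ℝ}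
    (hν : ν Sᶜ = 0) {k : ℕ} {ω : ℕ → ℝ} (hω : ω ∈ coverEvent r S k) : eMart μ r ν k ω = 0 := by
  have hS : ∀ᵐ x ∂ν, x ∈ S := hν
  rw [eMart, ← lintegral_zero (μ := ν)]
  refine lintegral_congr_ae ?_
  filter_upwards [hS] with x hx
  have : ω ∉ avoidEvent r k x := by
    have h := hω hx
    simp only [mem_iUnion] at h
    obtain ⟨n, hn, h⟩ := h
    exact fun h' => h' n hn (mem_ball_comm.1 h)
  simp [avoidDensity, this]

/-- A second moment bound: a nonnegative function of mean one and second moment at most `C` is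
nonzero with probability at least `(4 C)⁻¹`. -/
lemma inv_le_measure_ne_zero {Ω : Type*} [MeasurableSpace Ω] (P : Measure Ω)
    {f : Ω → ℝ≥0∞} (hf : Measurable f) (h1 : ∫⁻ ω, f ω ∂P = 1) {C : ℝ≥0∞} (hC0 : C ≠ 0)
    (hC : C ≠ ∞) (h2 : ∫⁻ ω, f ω ^ 2 ∂P ≤ C) : (4 * C)⁻¹ ≤ P {ω | f ω ≠ 0} := by
  have ht0 : 2 * C ≠ 0 := mul_ne_zero two_ne_zero hC0
  have htt : 2 * C ≠ ∞ := ENNReal.mul_ne_top (by simp) hC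
  have hm : MeasurableSet {ω | f ω ≠ 0} := hf (measurableSet_singleton 0).compl
  have hpt : ∀ ω, f ω ≤ 2 * C * {ω | f ω ≠ 0}.indicator 1 ω + (2 * C)⁻¹ * f ω ^ 2 := by
    intro ω
    by_cases h0 : f ω = 0
    · simp [h0]
    rcases le_total (f ω) (2 * C) with h | h
    · rw [indicator_of_mem (by exact h0), Pi.one_apply, mul_one]
      exact h.trans le_self_add
    · refine le_trans ?_ le_add_self
      calc f ω = (2 * C)⁻¹ * (2 * C) * f ω := by rw [ENNReal.inv_mul_cancel ht0 htt, one_mul]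
        _ ≤ (2 * C)⁻¹ * (f ω * f ω) := by rw [mul_assoc]; gcongr
        _ = _ := by rw [sq]
  have hmean : 1 ≤ 2 * C * P {ω | f ω ≠ 0} + 2⁻¹ := by
    calc 1 = ∫⁻ ω, f ω ∂P := h1.symm
      _ ≤ ∫⁻ ω, (2 * C * {ω | f ω ≠ 0}.indicator 1 ω + (2 * C)⁻¹ * f ω ^ 2) ∂P :=
        lintegral_mono hpt
      _ = 2 * C * P {ω | f ω ≠ 0} + (2 * C)⁻¹ * ∫⁻ ω, f ω ^ 2 ∂P := by
        rw [lintegral_add_right _ ((hf.pow_const 2).const_mul _),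
          lintegral_const_mul _ (measurable_one.indicator hm), lintegral_indicator_one hm,
          lintegral_const_mul _ (hf.pow_const 2)]
      _ ≤ 2 * C * P {ω | f ω ≠ 0} + (2 * C)⁻¹ * C := by gcongr
      _ = _ := by
        rw [ENNReal.mul_inv (.inl two_ne_zero) (.inl (by simp)), mul_assoc 2⁻¹,
          ENNReal.inv_mul_cancel hC0 hC, mul_one]
  have hhalf : 2⁻¹ ≤ 2 * C * P {ω | f ω ≠ 0} := by
    rw [← ENNReal.one_sub_inv_two]
    exact tsub_le_iff_right.2 hmean
  have h4 : 1 ≤ 4 * C * P {ω | f ω ≠ 0} := by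
    calc (1 : ℝ≥0∞) = 2 * 2⁻¹ := (ENNReal.mul_inv_cancel two_ne_zero (by simp)).symm
      _ ≤ 2 * (2 * C * P {ω | f ω ≠ 0}) := by gcongr
      _ = _ := by ring
  exact ENNReal.inv_le_iff_le_mul (fun _ => mul_ne_zero four_ne_zero hC0)
    (fun h => absurd h (ENNReal.mul_ne_top (by simp) hC)) |>.2 h4

lemma iidLaw_subset_coverSet_lt_one (μ : Measure ℝ) [IsProbabilityMeasure μ] (r : ℕ → ℝ)
    {A S : Set ℝ} (hS : IsCompact S) (hSA : S ⊆ A) (ν : Measure ℝ) [IsProbabilityMeasure ν]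
    (hνS : ν Sᶜ = 0) (hν : ∀ k, ∀ᵐ x ∂ν, avoidProb μ r k x ≠ 0) {C : ℝ≥0∞} (hC : C ≠ ∞)
    (h2 : ∀ k, ∫⁻ ω, eMart μ r ν k ω ^ 2 ∂(iidLaw μ) ≤ C) :
    iidLaw μ {ω | A ⊆ coverSet r ω} < 1 := by
  have hC0 : max C 1 ≠ 0 := (zero_lt_one.trans_le (le_max_right C 1)).ne'
  have hCtop : max C 1 ≠ ∞ := by simp [hC]
  have hbound : ∀ k, iidLaw μ (coverEvent r S k) ≤ 1 - (4 * max C 1)⁻¹ := by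
    intro k
    have hm : MeasurableSet {ω | eMart μ r ν k ω ≠ 0} :=
      measurable_eMart μ r ν k (measurableSet_singleton 0).compl
    calc iidLaw μ (coverEvent r S k) ≤ iidLaw μ {ω | eMart μ r ν k ω ≠ 0}ᶜ :=
          measure_mono fun ω hω h => h (eMart_eq_zero_of_mem_coverEvent μ r hνS hω)
      _ = 1 - iidLaw μ {ω | eMart μ r ν k ω ≠ 0} := prob_compl_eq_one_sub hm
      _ ≤ _ := tsub_le_tsub_left (inv_le_measure_ne_zero _ (measurable_eMart μ r ν k)
          (lintegral_eMart μ r ν k (hν k)) hC0 hCtop ((h2 k).trans (le_max_left _ _))) 1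
  calc iidLaw μ {ω | A ⊆ coverSet r ω}
      ≤ iidLaw μ (⋃ k, coverEvent r S k) := measure_mono (setOf_subset_coverSet_subset r hS hSA)
    _ = ⨆ k, iidLaw μ (coverEvent r S k) := (monotone_coverEvent r S).measure_iUnion
    _ ≤ 1 - (4 * max C 1)⁻¹ := iSup_le hbound
    _ < 1 := ENNReal.sub_lt_self (by simp) one_ne_zero
      (ENNReal.inv_ne_zero.2 (ENNReal.mul_ne_top (by simp) hCtop))

/-- Probabilistic form of the main theorem: an analytic set `A ⊆ ℝ` is `ℙ_μ`-a.s. covered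
by `E_r` iff the second moments `𝔼(M_{k,ν}²)` are unbounded for every Borel probability
measure `ν` whose support is a compact subset of `A`. -/
theorem covering_iff_unbounded_second_moments
    (μ : Measure ℝ) [IsProbabilityMeasure μ]
    (P : Measure (ℕ → ℝ))
    (hP : ∀ (s : Finset ℕ) (f : ℕ → Set ℝ), (∀ n, MeasurableSet (f n)) →
      P {ω | ∀ n ∈ s, ω n ∈ f n} = ∏ n ∈ s, μ (f n))
    (r : ℕ → ℝ) (hmono : Antitone r) (hpos : ∀ n, 0 < r n)
    (hlim : Tendsto r atTop (𝓝 0))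
    (hsmall : (⨆ x ∈ msupport μ, μ (ball x (r 0))) < 1)
    (A : Set ℝ) (hne : A.Nonempty) (hA : MeasureTheory.AnalyticSet A) :
    P {ω | A ⊆ coverSet r ω} = 1 ↔
      ∀ ν : Measure ℝ, IsProbabilityMeasure ν →
        IsCompact (msupport ν) → msupport ν ⊆ A → ν (msupport ν)ᶜ = 0 →
        ∀ C : ℝ, ∃ k : ℕ, C < ∫ ω, (Mart μ r ν k ω) ^ 2 ∂P := by
  obtain rfl : P = iidLaw μ := Measure.eq_infinitePi _ fun s t ht => by
    rw [← hP s t ht]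
    rfl
  set c : ℝ≥0∞ := (1 - ⨆ x ∈ msupport μ, μ (ball x (r 0)))⁻¹ with hcdef
  have hctop : c ≠ ∞ := ENNReal.inv_ne_top.2 (tsub_pos_of_lt hsmall).ne'
  have hc : ∀ x ∈ msupport μ, ∀ n, (μ (ball x (r n))ᶜ)⁻¹ ≤ c := fun x hx n =>
    inv_measure_compl_ball_le μ hmono hx n
  have hae : ∀ ν : Measure ℝ, ∀ S ⊆ msupport μ, ν Sᶜ = 0 →
      ∀ᵐ x ∂ν, ∀ n, (μ (ball x (r n))ᶜ)⁻¹ ≤ c := by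
    intro ν S hS hν
    have hmem : ∀ᵐ x ∂ν, x ∈ S := hν
    filter_upwards [hmem] with x hx using hc x (hS hx)
  constructor
  · intro hcover ν hν hcomp hsub hnull C
    have hAX : A ⊆ msupport μ := fun x hxA => by
      by_contra hx
      simp [iidLaw_subset_coverSet_eq_zero hlim hxA hx] at hcover
    have hcν := hae ν _ (hsub.trans hAX) hnull
    by_contra! hC
    refine (iidLaw_subset_coverSet_lt_one μ r hcomp hsub ν hnull (fun k => ?_)
      (ENNReal.ofReal_ne_top (r := C)) fun k => ?_).ne hcover
    · filter_upwards [hcν] with x hx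
      refine Finset.prod_ne_zero_iff.2 fun n _ h => hctop ?_
      simpa [h] using hx n
    · rw [← ENNReal.ofReal_toReal (lintegral_eMart_sq_lt_top μ r ν k hctop hcν).ne,
        ← integral_Mart_sq μ r ν k hctop hcν]
      exact ENNReal.ofReal_le_ofReal (hC k)
  · intro hunb
    by_contra hcover
    by_cases hAX : A ⊆ msupport μ
    · have hcompl : iidLaw μ {ω | A ⊆ coverSet r ω}ᶜ ≠ 0 := fun h =>
        hcover ((prob_compl_eq_zero_iff₀ (NullMeasurableSet.of_compl (.of_null h))).1 h)
      obtain ⟨N, hN⟩ : ∃ N, iidLaw μ (missEvent r N A) ≠ 0 := by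
        by_contra! h
        exact hcompl (measure_mono_null (compl_subset_coverSet r A) (measure_iUnion_null h))
      obtain ⟨K, hKA, hK, hKpos⟩ := exists_isCompact_missEvent_pos (iidLaw μ) r N hA hN
      obtain ⟨ν, hν, hνK, C, hC, h2⟩ := exists_measure_lintegral_eMart_sq_le μ r N hK hctop
        (fun m x hx => hc x (hAX (hKA hx)) m) hKpos
      have hcν := hae ν K (hKA.trans hAX) hνK
      have hsub : msupport ν ⊆ K := by
        rw [msupport_eq_support]
        exact Measure.support_subset_of_isClosed hK.isClosed hνK
      obtain ⟨k, hk⟩ := hunb ν hν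
        (hK.of_isClosed_subset (by rw [msupport_eq_support]; exact Measure.isClosed_support) hsub)
        (hsub.trans hKA) (by rw [msupport_eq_support]; exact Measure.measure_compl_support)
        C.toReal
      rw [integral_Mart_sq μ r ν k hctop hcν] at hk
      exact hk.not_ge (ENNReal.toReal_mono hC (h2 k))
    · obtain ⟨x, hxA, hx⟩ := Set.not_subset.1 hAX
      obtain ⟨C, hC⟩ := exists_bound_integral_Mart_sq_dirac μ hlim hx
      obtain ⟨k, hk⟩ := hunb (Measure.dirac x) inferInstance
        (by rw [msupport_dirac]; exact isCompact_singleton)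
        (by rw [msupport_dirac]; exact singleton_subset_iff.2 hxA)
        (by rw [msupport_dirac]; simp) C
      exact hk.not_ge (hC k)

end
end

section
/- Let μ be a Borel probability measure on ℝ, let r = (r_k)_{k≥1} be a non-increasing sequence of positive real numbers tending to zero, let ε > 0, and let A ⊆ ℝ be an analytic set such that ∑_{k=1}^∞ μ(B(x,r_k))^{1+ε} = ∞ for every x ∈ A. Then ℙ_μ({ω : A ⊆ E_r(ω)}) = 1. -/
open MeasureTheory Metric Filter Set
open scoped ENNReal Topology

noncomputable section

/-- A nested family of sets indexed by a bounded set of reals, all of measure at least `c`, has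
a common part of measure at least `c`. -/
theorem exists_common_subset_of_antitone (μ : Measure ℝ) [IsFiniteMeasure μ] {f : ℝ → Set ℝ}
    (hf : Antitone f) (hmeas : ∀ x, MeasurableSet (f x)) {S : Set ℝ} (hne : S.Nonempty)
    (hbdd : BddAbove S) {c : ℝ≥0∞} (hc : ∀ x ∈ S, c ≤ μ (f x)) :
    ∃ T, MeasurableSet T ∧ c ≤ μ T ∧ ∀ x ∈ S, T ⊆ f x := by
  have hlub := isLUB_csSup hne hbdd
  by_cases hmem : sSup S ∈ S
  · exact ⟨f (sSup S), hmeas _, hc _ hmem, fun x hx => hf (hlub.1 hx)⟩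
  · obtain ⟨u, hu, -, hlim, huS⟩ := hlub.exists_seq_strictMono_tendsto_of_notMem hmem hne
    refine ⟨⋂ n, f (u n), MeasurableSet.iInter fun n => hmeas _, ?_, fun x hx => ?_⟩
    · have h := tendsto_measure_iInter_atTop (μ := μ) (s := fun n => f (u n))
        (fun n => (hmeas _).nullMeasurableSet) (hf.comp_monotone hu.monotone)
        ⟨0, measure_ne_top μ _⟩
      exact ge_of_tendsto' h fun n => hc _ (huS n)
    · have hlt : x < sSup S := lt_of_le_of_ne (hlub.1 hx) fun h => hmem (h ▸ hx)
      obtain ⟨n, hn⟩ := (hlim.eventually (lt_mem_nhds hlt)).exists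
      exact (iInter_subset _ n).trans (hf hn.le)

/-- The cells of the grid of mesh `ρ`. -/
def gridCell (ρ : ℝ) (k : ℤ) : Set ℝ := Ico (k • ρ) ((k + 1) • ρ)

theorem measurableSet_gridCell (ρ : ℝ) (k : ℤ) : MeasurableSet (gridCell ρ k) :=
  measurableSet_Ico

/-- The points `x` of one cell whose balls meet a given cell in measure at least `c` share a
piece of the latter cell of measure at least `c`. -/
theorem exists_common_subset_ball (μ : Measure ℝ) [IsFiniteMeasure μ] {ρ : ℝ} (hρ : 0 < ρ)
    {c : ℝ≥0∞} (k l : ℤ) (hk : c ≤ μ (gridCell ρ k)) :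
    ∃ T, MeasurableSet T ∧ c ≤ μ T ∧
      ∀ x ∈ gridCell ρ l, c ≤ μ (ball x ρ ∩ gridCell ρ k) → T ⊆ ball x ρ := by
  set S := {x | x ∈ gridCell ρ l ∧ c ≤ μ (ball x ρ ∩ gridCell ρ k)} with hS
  rcases S.eq_empty_or_nonempty with hemp | hne
  · refine ⟨gridCell ρ k, measurableSet_gridCell ρ k, hk, fun x hx hcx => ?_⟩
    have : x ∈ S := ⟨hx, hcx⟩
    simp [hemp] at this
  rcases lt_trichotomy k l with hkl | rfl | hkl
  · have hcell : (k + 1) • ρ ≤ l • ρ := zsmul_le_zsmul_left hρ.le hkl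
    obtain ⟨T, hT, hcT, hTS⟩ := exists_common_subset_of_antitone μ
      (f := fun x => Ioi (x - ρ) ∩ gridCell ρ k) (S := S) (c := c)
      (fun x y hxy => inter_subset_inter_left _ (Ioi_subset_Ioi (by linarith)))
      (fun x => measurableSet_Ioi.inter (measurableSet_gridCell ρ k)) hne
      ⟨(l + 1) • ρ, fun x hx => hx.1.2.le⟩
      (fun x hx => hx.2.trans (measure_mono (inter_subset_inter_left _ fun y hy => by
        rw [Real.ball_eq_Ioo] at hy; exact hy.1)))
    refine ⟨T, hT, hcT, fun x hx hcx y hy => ?_⟩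
    have h := hTS x ⟨hx, hcx⟩ hy
    rw [Real.ball_eq_Ioo]
    exact ⟨h.1, by linarith [h.2.2, hx.1]⟩
  · refine ⟨gridCell ρ k, measurableSet_gridCell ρ k, hk, fun x hx _ y hy => ?_⟩
    have h1 := hx.1
    have h2 := hx.2
    have h3 := hy.1
    have h4 := hy.2
    simp only [add_smul, one_smul] at h2 h4
    rw [Real.ball_eq_Ioo]
    constructor <;> linarith
  · have hcell : (l + 1) • ρ ≤ k • ρ := zsmul_le_zsmul_left hρ.le hkl
    obtain ⟨T, hT, hcT, hTS⟩ := exists_common_subset_of_antitone μ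
      (f := fun x => Iio (-x + ρ) ∩ gridCell ρ k) (S := Neg.neg ⁻¹' S) (c := c)
      (fun x y hxy => inter_subset_inter_left _ (Iio_subset_Iio (by linarith)))
      (fun x => measurableSet_Iio.inter (measurableSet_gridCell ρ k))
      (by obtain ⟨x, hx⟩ := hne; exact ⟨-x, by simpa using hx⟩)
      ⟨-(l • ρ), fun x hx => by have := hx.1.1; linarith⟩
      (fun x hx => hx.2.trans (measure_mono (inter_subset_inter_left _ fun y hy => by
        rw [Real.ball_eq_Ioo] at hy; exact hy.2)))
    refine ⟨T, hT, hcT, fun x hx hcx y hy => ?_⟩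
    have h := hTS (-x) (by simpa using (show x ∈ S from ⟨hx, hcx⟩)) hy
    rw [Real.ball_eq_Ioo]
    have h1 : y < x + ρ := by simpa using h.1
    exact ⟨by linarith [h.2.1, hx.2], h1⟩

theorem exists_mem_gridCell {ρ : ℝ} (hρ : 0 < ρ) (x : ℝ) : ∃ l : ℤ, x ∈ gridCell ρ l := by
  obtain ⟨l, hl, -⟩ := existsUnique_zsmul_near_of_pos hρ x
  exact ⟨l, hl⟩

/-- A ball of radius `ρ` has a third of its mass in one of the three cells around its centre. -/
theorem exists_le_measure_ball_inter_gridCell (μ : Measure ℝ) {ρ : ℝ}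
    {c : ℝ≥0∞} {x : ℝ} {l : ℤ} (hx : x ∈ gridCell ρ l) (hc : 3 * c ≤ μ (ball x ρ)) :
    ∃ k ∈ ({l - 1, l, l + 1} : Finset ℤ), c ≤ μ (ball x ρ ∩ gridCell ρ k) := by
  by_contra! h
  have h1 := h (l - 1) (by simp)
  have h2 := h l (by simp)
  have h3 := h (l + 1) (by simp)
  have hsub : ball x ρ ⊆ (ball x ρ ∩ gridCell ρ (l - 1)) ∪ (ball x ρ ∩ gridCell ρ l) ∪
      (ball x ρ ∩ gridCell ρ (l + 1)) := by
    intro y hy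
    have hy' := hy
    rw [Real.ball_eq_Ioo] at hy'
    obtain ⟨hy1, hy2⟩ := hy'
    obtain ⟨hx1, hx2⟩ := hx
    simp only [gridCell, mem_union, mem_inter_iff, mem_Ico, hy, true_and, add_smul, sub_smul,
      one_smul] at hx1 hx2 ⊢
    grind
  have hle : μ (ball x ρ) ≤ μ (ball x ρ ∩ gridCell ρ (l - 1)) + μ (ball x ρ ∩ gridCell ρ l) +
      μ (ball x ρ ∩ gridCell ρ (l + 1)) :=
    (measure_mono hsub).trans ((measure_union_le _ _).trans
      (add_le_add_left (measure_union_le _ _) _))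
  have hlt := hle.trans_lt (ENNReal.add_lt_add (ENNReal.add_lt_add h1 h2) h3)
  refine absurd (hc.trans_lt hlt) (not_lt.2 (le_of_eq ?_))
  ring

/-- All balls of radius `ρ` and measure at least `3 * c` are tested by a family of at most
`3 / c` sets of measure at least `c`. -/
theorem exists_finset_common_subset_ball (μ : Measure ℝ) [IsProbabilityMeasure μ] {ρ : ℝ}
    (hρ : 0 < ρ) {c : ℝ≥0∞} (hc0 : c ≠ 0) :
    ∃ (F : Finset (ℤ × ℤ)) (T : ℤ × ℤ → Set ℝ), (F.card : ℝ≥0∞) ≤ 3 * c⁻¹ ∧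
      (∀ i ∈ F, MeasurableSet (T i) ∧ c ≤ μ (T i)) ∧
      ∀ x, 3 * c ≤ μ (ball x ρ) → ∃ i ∈ F, T i ⊆ ball x ρ := by
  classical
  have hsum : ∑' k : ℤ, μ (gridCell ρ k) ≤ 1 :=
    (tsum_meas_le_meas_iUnion_of_disjoint μ (measurableSet_gridCell ρ)
      (pairwise_disjoint_Ico_zsmul ρ)).trans prob_le_one
  obtain ⟨hfin, hcard⟩ := ENNReal.finset_card_const_le_le_of_tsum_le ENNReal.one_ne_top hsum hc0
  have hex : ∀ i : ℤ × ℤ, ∃ T, c ≤ μ (gridCell ρ i.1) → MeasurableSet T ∧ c ≤ μ T ∧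
      ∀ x ∈ gridCell ρ (i.1 + i.2), c ≤ μ (ball x ρ ∩ gridCell ρ i.1) → T ⊆ ball x ρ := by
    intro i
    by_cases hi : c ≤ μ (gridCell ρ i.1)
    · obtain ⟨T, hT⟩ := exists_common_subset_ball μ hρ i.1 (i.1 + i.2) hi
      exact ⟨T, fun _ => hT⟩
    · exact ⟨∅, fun h => absurd h hi⟩
  choose T hT using hex
  refine ⟨hfin.toFinset ×ˢ {-1, 0, 1}, T, ?_, fun i hi => ?_, fun x hx => ?_⟩
  · rw [Finset.card_product]
    have h3 : ({-1, 0, 1} : Finset ℤ).card = 3 := rfl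
    rw [h3, Nat.cast_mul, mul_comm]
    rw [one_div] at hcard
    exact mul_le_mul' (by norm_num) hcard
  · have h := hT i (by simpa using (Finset.mem_product.1 hi).1)
    exact ⟨h.1, h.2.1⟩
  · obtain ⟨l, hl⟩ := exists_mem_gridCell hρ x
    obtain ⟨k, hk, hck⟩ := exists_le_measure_ball_inter_gridCell μ hl hx
    have hck' : c ≤ μ (gridCell ρ k) := hck.trans (measure_mono inter_subset_right)
    refine ⟨(k, l - k), ?_, (hT (k, l - k) hck').2.2 x (by simpa using hl) hck⟩
    rw [Finset.mem_product]
    refine ⟨by simpa using hck', ?_⟩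
    simp only [Finset.mem_insert, Finset.mem_singleton] at hk ⊢
    omega

/-- The probability that some point whose `ρ`-ball has measure at least `3 * c` is missed by
all the balls with index in `s`. -/
theorem measure_exists_uncovered_le (μ : Measure ℝ) [IsProbabilityMeasure μ]
    (P : Measure (ℕ → ℝ))
    (hP : ∀ (s : Finset ℕ) (f : ℕ → Set ℝ), (∀ n, MeasurableSet (f n)) →
      P {ω | ∀ n ∈ s, ω n ∈ f n} = ∏ n ∈ s, μ (f n))
    {r : ℕ → ℝ} {ρ : ℝ} (hρ : 0 < ρ) (s : Finset ℕ) (hs : ∀ n ∈ s, ρ ≤ r n)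
    {c : ℝ≥0∞} (hc0 : c ≠ 0) :
    P {ω | ∃ x, 3 * c ≤ μ (ball x ρ) ∧ ∀ n ∈ s, x ∉ ball (ω n) (r n)} ≤
      3 * c⁻¹ * (1 - c) ^ s.card := by
  obtain ⟨F, T, hF, hT, hcov⟩ := exists_finset_common_subset_ball μ hρ hc0
  have hsub : {ω : ℕ → ℝ | ∃ x, 3 * c ≤ μ (ball x ρ) ∧ ∀ n ∈ s, x ∉ ball (ω n) (r n)} ⊆
      ⋃ i ∈ F, {ω : ℕ → ℝ | ∀ n ∈ s, ω n ∈ (T i)ᶜ} := by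
    rintro ω ⟨x, hx, hmiss⟩
    obtain ⟨i, hi, hTi⟩ := hcov x hx
    refine mem_iUnion₂.2 ⟨i, hi, fun n hn hmem => hmiss n hn ?_⟩
    exact mem_ball_comm.1 (ball_subset_ball (hs n hn) (hTi hmem))
  calc _ ≤ P (⋃ i ∈ F, {ω : ℕ → ℝ | ∀ n ∈ s, ω n ∈ (T i)ᶜ}) := measure_mono hsub
    _ ≤ ∑ i ∈ F, P {ω : ℕ → ℝ | ∀ n ∈ s, ω n ∈ (T i)ᶜ} := measure_biUnion_finset_le _ _
    _ ≤ ∑ _i ∈ F, (1 - c) ^ s.card := by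
        refine Finset.sum_le_sum fun i hi => ?_
        rw [hP s (fun _ => (T i)ᶜ) fun _ => (hT i hi).1.compl]
        refine Finset.prod_le_pow_card _ _ _ fun n _ => ?_
        rw [prob_compl_eq_one_sub (hT i hi).1]
        exact tsub_le_tsub_left (hT i hi).2 1
    _ = F.card * (1 - c) ^ s.card := by rw [Finset.sum_const, nsmul_eq_mul]
    _ ≤ _ := mul_le_mul_left hF _

/-- If `∑ a_k ^ p` diverges and `1 < s * p`, then `a_k` exceeds `(k + 1) ^ (-s)` infinitely
often. -/
theorem frequently_rpow_le_of_tsum_rpow_eq_top {a : ℕ → ℝ≥0∞} (ha : ∀ k, a k ≠ ∞) {p s : ℝ}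
    (hp : 0 < p) (hsp : 1 < s * p) (hdiv : ∑' k, a k ^ p = ∞) :
    ∃ᶠ k : ℕ in atTop, ENNReal.ofReal (((k : ℝ) + 1) ^ (-s)) ≤ a k := by
  intro hev
  obtain ⟨N, hN⟩ := eventually_atTop.1 hev
  have hsum : Summable fun k : ℕ => ((k : ℝ) + 1) ^ (-(s * p)) := by
    refine ((Real.summable_one_div_nat_add_rpow 1 (s * p)).2 hsp).congr fun k => ?_
    rw [abs_of_nonneg (by positivity), Real.rpow_neg (by positivity), one_div]
  have htail : ∑' k, a (k + N) ^ p ≠ ∞ := by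
    refine ne_top_of_le_ne_top ((summable_nat_add_iff N).2 hsum).tsum_ofReal_ne_top
      (ENNReal.tsum_le_tsum fun k => ?_)
    have h := (not_le.1 (hN (k + N) (Nat.le_add_left N k))).le
    refine (ENNReal.rpow_le_rpow h hp.le).trans_eq ?_
    rw [ENNReal.ofReal_rpow_of_nonneg (by positivity) hp.le, ← Real.rpow_mul (by positivity)]
    rw [neg_mul]
  rw [← ENNReal.summable.sum_add_tsum_nat_add' (k := N)] at hdiv
  rcases ENNReal.add_eq_top.1 hdiv with h | h
  · obtain ⟨k, -, hk⟩ := ENNReal.sum_eq_top.1 h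
    exact ENNReal.rpow_ne_top_of_nonneg hp.le (ha k) hk
  · exact htail h

theorem summable_rpow_mul_exp_neg_rpow (b : ℝ) {a δ : ℝ} (ha : 0 < a) (hδ : 0 < δ) :
    Summable fun k : ℕ => ((k : ℝ) + 1) ^ b * Real.exp (-a * ((k : ℝ) + 1) ^ δ) := by
  have hlim : Tendsto (fun k : ℕ => ((k : ℝ) + 1) ^ δ) atTop atTop :=
    (tendsto_rpow_atTop hδ).comp (tendsto_natCast_atTop_atTop.atTop_add tendsto_const_nhds)
  have hO := ((isLittleO_exp_neg_mul_rpow_atTop ha ((-2 - b) / δ)).comp_tendsto hlim).isBigO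
  have hO2 := (Asymptotics.isBigO_refl (fun k : ℕ => ((k : ℝ) + 1) ^ b) atTop).mul hO
  refine summable_of_isBigO_nat ((Real.summable_one_div_nat_add_rpow 1 2).2 one_lt_two)
    (hO2.congr_right fun k => ?_)
  have hk : (0 : ℝ) < (k : ℝ) + 1 := by positivity
  simp only [Function.comp]
  rw [← Real.rpow_mul hk.le, ← Real.rpow_add hk, abs_of_pos hk, one_div, ← Real.rpow_neg hk.le]
  congr 1
  field_simp
  ring

/-- If `∑_k μ(B(x,r_k))^{1+ε} = ∞` for every `x` in the analytic set `A`, then `A` is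
`ℙ_μ`-almost surely covered by `E_r`. -/
theorem covered_of_one_plus_eps_divergence
    (μ : Measure ℝ) [IsProbabilityMeasure μ]
    (P : Measure (ℕ → ℝ))
    (hP : ∀ (s : Finset ℕ) (f : ℕ → Set ℝ), (∀ n, MeasurableSet (f n)) →
      P {ω | ∀ n ∈ s, ω n ∈ f n} = ∏ n ∈ s, μ (f n))
    (r : ℕ → ℝ) (hmono : Antitone r) (hpos : ∀ n, 0 < r n)
    (hlim : Tendsto r atTop (𝓝 0))
    (ε : ℝ) (hε : 0 < ε)
    (A : Set ℝ) (hA : MeasureTheory.AnalyticSet A)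
    (hdiv : ∀ x ∈ A, (∑' k, μ (ball x (r k)) ^ (1 + ε : ℝ)) = ∞) :
    P {ω | A ⊆ coverSet r ω} = 1 := by
  have huniv : P univ = 1 := by simpa using hP ∅ (fun _ => univ) (fun _ => MeasurableSet.univ)
  set s : ℝ := (1 + ε / 2)⁻¹ with hs
  have hs1 : s < 1 := inv_lt_one_of_one_lt₀ (by linarith)
  have hsp : 1 < s * (1 + ε) := by
    rw [hs, inv_mul_eq_div, one_lt_div (by positivity)]
    linarith
  set q : ℕ → ℝ := fun k => ((k : ℝ) + 1) ^ (-s) / 3 with hq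
  have hqpos : ∀ k, 0 < q k := fun k => by positivity
  have h3q : ∀ k, 3 * ENNReal.ofReal (q k) = ENNReal.ofReal (((k : ℝ) + 1) ^ (-s)) := fun k => by
    rw [← ENNReal.ofReal_ofNat 3, ← ENNReal.ofReal_mul (by norm_num), hq]
    congr 1
    ring
  set bad : ℕ → Set (ℕ → ℝ) := fun k => {ω | ∃ x, 3 * ENNReal.ofReal (q k) ≤ μ (ball x (r k)) ∧
    ∀ n ∈ Finset.Icc (k / 2) k, x ∉ ball (ω n) (r n)} with hbad
  have hbound : ∀ k, P (bad k) ≤ ENNReal.ofReal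
      (9 * (((k : ℝ) + 1) ^ s * Real.exp (-(1 / 6) * ((k : ℝ) + 1) ^ (1 - s)))) := by
    intro k
    have hk : (0 : ℝ) < (k : ℝ) + 1 := by positivity
    have hq1 : q k ≤ 1 := by
      have := Real.rpow_le_one_of_one_le_of_nonpos (x := (k : ℝ) + 1) (z := -s)
        (by linarith [k.cast_nonneg (α := ℝ)]) (by rw [hs, neg_nonpos]; positivity)
      simp only [hq]
      linarith
    refine (measure_exists_uncovered_le μ P hP (hpos k) (Finset.Icc (k / 2) k)
      (fun n hn => hmono (Finset.mem_Icc.1 hn).2)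
      (ENNReal.ofReal_pos.2 (hqpos k)).ne').trans ?_
    rw [← ENNReal.ofReal_inv_of_pos (hqpos k), ← ENNReal.ofReal_one,
      ← ENNReal.ofReal_sub _ (hqpos k).le, ← ENNReal.ofReal_pow (by linarith),
      ← ENNReal.ofReal_ofNat 3, ← ENNReal.ofReal_mul (by norm_num),
      ← ENNReal.ofReal_mul (by have := hqpos k; positivity)]
    refine ENNReal.ofReal_le_ofReal ?_
    have hcard : ((k : ℝ) + 1) / 2 ≤ ((Finset.Icc (k / 2) k).card : ℝ) := by
      rw [Nat.card_Icc, div_le_iff₀ two_pos]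
      have : k + 1 ≤ (k + 1 - k / 2) * 2 := by omega
      exact_mod_cast this
    have hexp : (1 - q k) ^ (Finset.Icc (k / 2) k).card ≤
        Real.exp (-(1 / 6) * ((k : ℝ) + 1) ^ (1 - s)) := by
      refine (pow_le_pow_left₀ (by linarith) (Real.one_sub_le_exp_neg (q k)) _).trans ?_
      rw [← Real.exp_nat_mul, Real.exp_le_exp]
      have hmul : q k * (((k : ℝ) + 1) / 2) = 1 / 6 * ((k : ℝ) + 1) ^ (1 - s) := by
        rw [sub_eq_neg_add, Real.rpow_add_one hk.ne']
        simp only [hq]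
        ring
      nlinarith [mul_le_mul_of_nonneg_left hcard (hqpos k).le]
    have hinv : 3 * (q k)⁻¹ = 9 * ((k : ℝ) + 1) ^ s := by
      simp only [hq]
      rw [Real.rpow_neg hk.le, inv_div, div_inv_eq_mul]
      ring
    rw [hinv, mul_assoc]
    gcongr
  have hsum : ∑' k, P (bad k) ≠ ∞ := by
    refine ne_top_of_le_ne_top ?_ (ENNReal.tsum_le_tsum hbound)
    exact ((summable_rpow_mul_exp_neg_rpow s (by norm_num) (sub_pos.2 hs1)).mul_left
      9).tsum_ofReal_ne_top
  have hae : ∀ᵐ ω ∂P, A ⊆ coverSet r ω := by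
    filter_upwards [ae_eventually_notMem hsum] with ω hω x hx
    have hfreq := frequently_rpow_le_of_tsum_rpow_eq_top (fun k => measure_ne_top μ _)
      (by linarith) hsp (hdiv x hx)
    refine mem_iInter.2 fun m => ?_
    obtain ⟨k, hk, hgood, hkm⟩ :=
      (hfreq.and_eventually (hω.and (eventually_ge_atTop (2 * m)))).exists
    have h : ∃ n ∈ Finset.Icc (k / 2) k, x ∈ ball (ω n) (r n) := by
      by_contra! hmiss
      exact hgood ⟨x, (h3q k).trans_le hk, hmiss⟩
    obtain ⟨n, hn, hxn⟩ := h
    have hmn : m ≤ n := by have := (Finset.mem_Icc.1 hn).1; omega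
    exact mem_iUnion₂.2 ⟨n, hmn, hxn⟩
  rw [← huniv]
  exact measure_congr (eventuallyEq_univ.2 hae)

end
end
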